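/- Let d ∈ ℕ, 0 < θ ≤ ∞, 2 ≤ q ≤ ∞ and r > (1 − 1/θ)_+. Then ρ_m(S^r_θ A)_{L_q} ≲ m^{−(r + 1/θ + 1/q − 1)} · (log* m)^{(d−1)r + 3(r + 1/θ + 1/q − 1) + 1/2}. -/

import Mathlib

open MeasureTheory Real ENNReal

noncomputable section

namespace Paper

/-- The fundamental domain `[0,1)^d` of the `d`-dimensional torus `𝕋^d`. -/
def cube (d : ℕ) : Set (Fin d → ℝ) := Set.univ.pi fun _ => Set.Ico (0:ℝ) 1

/-- The trigonometric character `x ↦ e^{2π i k·x}`. -/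
def expk (d : ℕ) (k : Fin d → ℤ) (x : Fin d → ℝ) : ℂ :=
  Complex.exp (((2 * Real.pi * ∑ i, (k i : ℝ) * x i : ℝ) : ℂ) * Complex.I)

/-- Fourier coefficient `f̂(k) = ∫_{[0,1)^d} f(x) e^{-2π i k·x} dx`. -/
def fCoeff (d : ℕ) (f : (Fin d → ℝ) → ℂ) (k : Fin d → ℤ) : ℂ :=
  ∫ x in cube d, f x * expk d (-k) x

/-- The `L_q` (quasi-)norm on the torus, `q ∈ (0,∞]`, valued in `ℝ≥0∞`
(for `q = ∞` this is the essential supremum). -/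
def LqNorm (d : ℕ) (q : ℝ≥0∞) (f : (Fin d → ℝ) → ℂ) : ℝ≥0∞ :=
  eLpNorm f q (volume.restrict (cube d))

/-- The weight `∏_{i=1}^d (1+|k_i|)`. -/
def wt (d : ℕ) (k : Fin d → ℤ) : ℝ := ∏ i, (1 + |(k i : ℝ)|)

/-- The weighted Wiener (quasi-)norm `‖f‖_{S^r_θ A}`
(with the sup modification for `θ = ∞`); `A_θ` corresponds to `r = 0`,
the Wiener algebra `A` to `r = 0`, `θ = 1`. -/
def wienerNorm (d : ℕ) (r : ℝ) (θ : ℝ≥0∞) (f : (Fin d → ℝ) → ℂ) : ℝ≥0∞ :=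
  if θ = ∞ then ⨆ k : Fin d → ℤ, ENNReal.ofReal (wt d k ^ r) * (‖fCoeff d f k‖₊ : ℝ≥0∞)
  else (∑' k : Fin d → ℤ,
      (ENNReal.ofReal (wt d k ^ r) * (‖fCoeff d f k‖₊ : ℝ≥0∞)) ^ θ.toReal) ^ (1 / θ.toReal)

/-- Trigonometric polynomials with at most `m` terms. -/
def trigPoly (d m : ℕ) : Set ((Fin d → ℝ) → ℂ) :=
  {s | ∃ (Λ : Finset (Fin d → ℤ)) (a : (Fin d → ℤ) → ℂ),
    Λ.card ≤ m ∧ s = fun x => ∑ k ∈ Λ, a k * expk d k x}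

/-- Best `m`-term trigonometric approximation error of `f`, error measured by `X`. -/
def sigmaF (d m : ℕ) (X : ((Fin d → ℝ) → ℂ) → ℝ≥0∞) (f : (Fin d → ℝ) → ℂ) : ℝ≥0∞ :=
  ⨅ s ∈ trigPoly d m, X (f - s)

/-- The unit ball of the space (inside `L₁(𝕋^d)`) with (quasi-)norm `N`. -/
def unitBall (d : ℕ) (N : ((Fin d → ℝ) → ℂ) → ℝ≥0∞) : Set ((Fin d → ℝ) → ℂ) :=
  {f | IntegrableOn f (cube d) ∧ N f ≤ 1}

/-- Best `m`-term trigonometric width of the unit ball of `N`, error measured by `X`. -/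
def sigmaClass (d m : ℕ) (N X : ((Fin d → ℝ) → ℂ) → ℝ≥0∞) : ℝ≥0∞ :=
  ⨆ f ∈ unitBall d N, sigmaF d m X f

/-- `log*(m) = max (log₂ m) 1`. -/
def logStar (m : ℕ) : ℝ := max (Real.logb 2 m) 1

/-- Two-sided asymptotic equivalence `a_m ≍ b_m`. -/
def IsAsympEquiv (a : ℕ → ℝ≥0∞) (b : ℕ → ℝ) : Prop :=
  ∃ c C : ℝ, 0 < c ∧ 0 < C ∧ ∃ m₀ : ℕ, ∀ m : ℕ, m₀ ≤ m →
    ENNReal.ofReal (c * b m) ≤ a m ∧ a m ≤ ENNReal.ofReal (C * b m)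

/-- One-sided asymptotic bound `a_m ≲ b_m`. -/
def IsAsympLe (a : ℕ → ℝ≥0∞) (b : ℕ → ℝ) : Prop :=
  ∃ C : ℝ, 0 < C ∧ ∃ m₀ : ℕ, ∀ m : ℕ, m₀ ≤ m → a m ≤ ENNReal.ofReal (C * b m)

/-- Dyadic block `I_0 = {0}`, `I_n = {k : 2^{n-1} ≤ |k| < 2^n}` for `n ≥ 1`. -/
def blockF (n : ℕ) : Finset ℤ :=
  (Finset.Icc (-(2^n : ℤ)) (2^n)).filter fun k =>
    (n = 0 ∧ k = 0) ∨ (n ≠ 0 ∧ 2^(n-1) ≤ |k| ∧ |k| < 2^n)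

/-- The dyadic block projection `∑_{k ∈ I_j} f̂(k) e^{2π i k·x}`. -/
def blockProj (d : ℕ) (f : (Fin d → ℝ) → ℂ) (j : Fin d → ℕ) : (Fin d → ℝ) → ℂ :=
  fun x => ∑ k ∈ Fintype.piFinset (fun i => blockF (j i)), fCoeff d f k * expk d k x

/-- The mixed-smoothness Besov (quasi-)norm `‖f‖_{S^s_{p,θ}B}`
(with the sup modification for `θ = ∞`). -/
def besovNorm (d : ℕ) (s : ℝ) (p θ : ℝ≥0∞) (f : (Fin d → ℝ) → ℂ) : ℝ≥0∞ :=
  if θ = ∞ then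
    ⨆ j : Fin d → ℕ,
      ENNReal.ofReal ((2:ℝ) ^ (((∑ i, j i : ℕ) : ℝ) * s)) * LqNorm d p (blockProj d f j)
  else
    (∑' j : Fin d → ℕ,
      (ENNReal.ofReal ((2:ℝ) ^ (((∑ i, j i : ℕ) : ℝ) * s)) * LqNorm d p (blockProj d f j))
        ^ θ.toReal) ^ (1 / θ.toReal)

/-- The mixed-smoothness Sobolev norm `‖f‖_{S^s_p W}` (Littlewood–Paley form),
with `S^0_p W := L_p`. -/
def sobolevNorm (d : ℕ) (s : ℝ) (p : ℝ≥0∞) (f : (Fin d → ℝ) → ℂ) : ℝ≥0∞ :=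
  if s = 0 then LqNorm d p f
  else
    (∫⁻ x in cube d,
      ((∑' j : Fin d → ℕ,
        (ENNReal.ofReal ((2:ℝ) ^ (((∑ i, j i : ℕ) : ℝ) * s)) *
          (‖blockProj d f j x‖₊ : ℝ≥0∞)) ^ (2:ℕ)) ^ ((1:ℝ)/2)) ^ p.toReal) ^ (1 / p.toReal)

/-- Trigonometric polynomials with frequencies in `[-M,M]^d`. -/
def boxPoly (d M : ℕ) : Set ((Fin d → ℝ) → ℂ) :=
  {s | ∃ (Λ : Finset (Fin d → ℤ)) (a : (Fin d → ℤ) → ℂ),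
    (∀ k ∈ Λ, ∀ i, |k i| ≤ (M : ℤ)) ∧ s = fun x => ∑ k ∈ Λ, a k * expk d k x}

/-- Error of best approximation by trigonometric polynomials with
frequencies in `[-M,M]^d`, measured in `L_∞`. -/
def EBox (d M : ℕ) (f : (Fin d → ℝ) → ℂ) : ℝ≥0∞ :=
  ⨅ g ∈ boxPoly d M, LqNorm d ∞ (f - g)

/-- The `m`-th (non-linear) sampling width of the class of continuous functions
in the unit ball of `N`, error measured in `L_q`. -/
def samplingWidth (d m : ℕ) (N : ((Fin d → ℝ) → ℂ) → ℝ≥0∞) (q : ℝ≥0∞) : ℝ≥0∞ :=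
  ⨅ (t : Fin m → (Fin d → ℝ)) (_ : ∀ i, t i ∈ cube d)
    (R : (Fin m → ℂ) → ((Fin d → ℝ) → ℂ)),
    ⨆ f ∈ {f : (Fin d → ℝ) → ℂ | Continuous f ∧ N f ≤ 1},
      LqNorm d q (f - R fun i => f (t i))

theorem exists_le_of_weighted_sum_le {ι : Type*} [Fintype ι] (w a : ι → ℝ) (hw : ∀ i, 0 ≤ w i)
    (hw1 : ∑ i, w i = 1) {b : ℝ} (h : ∑ i, w i * a i ≤ b) : ∃ i, a i ≤ b := by
  by_contra! hcon
  have hlt : ∑ i, w i * b < ∑ i, w i * a i := by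
    obtain ⟨i, -, hi⟩ : ∃ i ∈ Finset.univ, 0 < w i := by
      by_contra! hneg
      have : ∑ i, w i ≤ 0 := Finset.sum_nonpos hneg
      linarith
    exact Finset.sum_lt_sum (fun j _ => mul_le_mul_of_nonneg_left (hcon j).le (hw j))
      ⟨i, Finset.mem_univ i, mul_lt_mul_of_pos_left (hcon i) hi⟩
  rw [← Finset.sum_mul, hw1, one_mul] at hlt
  linarith

/-- Derandomised exponential-moment form of Maurey's empirical method. -/
theorem exists_exp_moment_le {ι G : Type*} [Fintype ι] [Fintype G] (ψ : ι → G → ℝ)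
    (hψ : ∀ i x, |ψ i x| ≤ 1) (w : ι → ℝ) (hw : ∀ i, 0 ≤ w i) (hw1 : ∑ i, w i = 1)
    {l : ℝ} (hl : 0 ≤ l) (hl2 : l ≤ 1 / 2) (K : ℕ) :
    ∃ a : Fin K → ι, ∑ x, exp (l * ∑ j, (ψ (a j) x - ∑ i, w i * ψ i x)) ≤
      Fintype.card G * (1 + 4 * l ^ 2) ^ K := by
  induction K with
  | zero => exact ⟨Fin.elim0, by simp⟩
  | succ K ih =>
    obtain ⟨a, ha⟩ := ih
    set μ : G → ℝ := fun x => ∑ i, w i * ψ i x with hμ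
    have hμ1 : ∀ x, |μ x| ≤ 1 := fun x => by
      calc |μ x| ≤ ∑ i, |w i * ψ i x| := Finset.abs_sum_le_sum_abs _ _
        _ ≤ ∑ i, w i := Finset.sum_le_sum fun i _ => by
          rw [abs_mul, abs_of_nonneg (hw i)]
          exact mul_le_of_le_one_right (hw i) (hψ i x)
        _ = 1 := hw1
    set E : G → ℝ := fun x => exp (l * ∑ j, (ψ (a j) x - μ x)) with hE
    have key : ∑ i, w i * ∑ x, E x * exp (l * (ψ i x - μ x)) ≤
        Fintype.card G * (1 + 4 * l ^ 2) ^ (K + 1) := by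
      have hx : ∀ x, ∑ i, w i * exp (l * (ψ i x - μ x)) ≤ 1 + 4 * l ^ 2 := fun x => by
        have hi : ∀ i, exp (l * (ψ i x - μ x)) ≤ 1 + l * (ψ i x - μ x) + 4 * l ^ 2 := fun i => by
          have h1 := abs_le.1 (hψ i x)
          have h2 := abs_le.1 (hμ1 x)
          have hz : |ψ i x - μ x| ≤ 2 := by rw [abs_le]; constructor <;> linarith
          have hy : |l * (ψ i x - μ x)| ≤ 1 := by
            rw [abs_mul, abs_of_nonneg hl]
            nlinarith [abs_nonneg (ψ i x - μ x)]
          have h3 := (abs_le.1 (abs_exp_sub_one_sub_id_le hy)).2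
          have h4 : (l * (ψ i x - μ x)) ^ 2 ≤ 4 * l ^ 2 := by
            have h5 : |ψ i x - μ x| ^ 2 ≤ 2 ^ 2 := pow_le_pow_left₀ (abs_nonneg _) hz 2
            rw [mul_pow, ← sq_abs (ψ i x - μ x)]
            nlinarith [sq_nonneg l]
          linarith
        calc ∑ i, w i * exp (l * (ψ i x - μ x))
            ≤ ∑ i, w i * (1 + l * (ψ i x - μ x) + 4 * l ^ 2) :=
              Finset.sum_le_sum fun i _ => mul_le_mul_of_nonneg_left (hi i) (hw i)
          _ = ∑ i, ((1 + 4 * l ^ 2 - l * μ x) * w i + l * (w i * ψ i x)) :=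
              Finset.sum_congr rfl fun i _ => by ring
          _ = 1 + 4 * l ^ 2 := by
              rw [Finset.sum_add_distrib, ← Finset.mul_sum, ← Finset.mul_sum, hw1]
              simp only [hμ]; ring
      calc ∑ i, w i * ∑ x, E x * exp (l * (ψ i x - μ x))
          = ∑ x, E x * ∑ i, w i * exp (l * (ψ i x - μ x)) := by
            simp only [Finset.mul_sum]
            rw [Finset.sum_comm]
            exact Finset.sum_congr rfl fun x _ => Finset.sum_congr rfl fun i _ => by ring
        _ ≤ ∑ x, E x * (1 + 4 * l ^ 2) :=
            Finset.sum_le_sum fun x _ => mul_le_mul_of_nonneg_left (hx x) (exp_pos _).le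
        _ = (∑ x, E x) * (1 + 4 * l ^ 2) := by rw [Finset.sum_mul]
        _ ≤ _ := by
            have h6 : (0 : ℝ) ≤ 1 + 4 * l ^ 2 := by positivity
            rw [pow_succ (1 + 4 * l ^ 2) K, ← mul_assoc]
            exact mul_le_mul_of_nonneg_right ha h6
    obtain ⟨i, hi⟩ := exists_le_of_weighted_sum_le w _ hw hw1 key
    refine ⟨Fin.snoc a i, le_trans (le_of_eq ?_) hi⟩
    refine Finset.sum_congr rfl fun x _ => ?_
    rw [Fin.sum_univ_castSucc]
    simp only [Fin.snoc_castSucc, Fin.snoc_last, hE]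
    rw [mul_add, exp_add]

theorem maurey_real {ι G : Type*} [Fintype ι] [Fintype G] (ψ : ι → G → ℝ)
    (hψ : ∀ i x, |ψ i x| ≤ 1) (w : ι → ℝ) (hw : ∀ i, 0 ≤ w i) (hw1 : ∑ i, w i = 1)
    {ε : ℝ} (hε : 0 < ε) (hε2 : ε ≤ 4) {K : ℕ}
    (hK : 16 * Real.log (Fintype.card G) ≤ K * ε ^ 2) :
    ∃ a : Fin K → ι, ∀ x, ∑ j, ψ (a j) x - K * ∑ i, w i * ψ i x ≤ K * ε := by
  obtain ⟨a, ha⟩ := exists_exp_moment_le ψ hψ w hw hw1 (l := ε / 8) (by positivity)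
    (by linarith) K
  refine ⟨a, fun x => ?_⟩
  have hG : (0 : ℝ) < Fintype.card G := by
    exact_mod_cast Fintype.card_pos_iff.2 ⟨x⟩
  set S := ∑ j, (ψ (a j) x - ∑ i, w i * ψ i x) with hS
  have hSeq : ∑ j, ψ (a j) x - K * ∑ i, w i * ψ i x = S := by
    rw [hS, Finset.sum_sub_distrib]; simp
  rw [hSeq]
  have h1 : exp (ε / 8 * S) ≤ Fintype.card G * (1 + 4 * (ε / 8) ^ 2) ^ K :=
    (Finset.single_le_sum (f := fun x => exp (ε / 8 * ∑ j, (ψ (a j) x - ∑ i, w i * ψ i x)))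
      (fun x _ => (exp_pos _).le) (Finset.mem_univ x)).trans ha
  have h2 : (1 + 4 * (ε / 8) ^ 2) ^ K ≤ exp (K * (4 * (ε / 8) ^ 2)) := by
    rw [exp_nat_mul]
    exact pow_le_pow_left₀ (by positivity) (by linarith [add_one_le_exp (4 * (ε / 8) ^ 2)]) K
  have h3 : exp (ε / 8 * S) ≤ exp (Real.log (Fintype.card G) + K * (4 * (ε / 8) ^ 2)) := by
    rw [exp_add, exp_log hG]
    exact h1.trans (mul_le_mul_of_nonneg_left h2 hG.le)
  have h4 := exp_le_exp.1 h3
  have h5 : ε * S ≤ ε * (K * ε) := by nlinarith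
  exact le_of_mul_le_mul_left h5 hε

/-- Maurey's lemma in the uniform norm over a finite set. -/
theorem maurey_complex {ι G : Type*} [Fintype ι] [Fintype G] (ψ : ι → G → ℂ)
    (hψ : ∀ i x, ‖ψ i x‖ ≤ 1) (w : ι → ℝ) (hw : ∀ i, 0 ≤ w i) (hw1 : ∑ i, w i = 1)
    {ε : ℝ} (hε : 0 < ε) (hε2 : ε ≤ 4) {K : ℕ} (hK0 : 0 < K)
    (hK : 64 * Real.log (4 * Fintype.card G) ≤ K * ε ^ 2) :
    ∃ a : Fin K → ι, ∀ x, ‖∑ i, (w i : ℂ) * ψ i x - (K : ℂ)⁻¹ * ∑ j, ψ (a j) x‖ ≤ ε := by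
  let σ : Fin 4 → ℂ := ![1, -1, Complex.I, -Complex.I]
  have hσ : ∀ b, ‖σ b‖ = 1 := by intro b; fin_cases b <;> simp [σ]
  obtain ⟨a, ha⟩ := maurey_real (G := G × Fin 4) (fun i p => (σ p.2 * ψ i p.1).re)
    (fun i p => (Complex.abs_re_le_norm _).trans (by rw [norm_mul, hσ, one_mul]; exact hψ _ _))
    w hw hw1 (ε := ε / 2) (by positivity) (by linarith) (K := K) (by
      rw [Fintype.card_prod, Fintype.card_fin]; push_cast
      rw [mul_comm (Fintype.card G : ℝ)]; linarith)
  refine ⟨a, fun x => ?_⟩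
  have hKr : (0 : ℝ) < K := by exact_mod_cast hK0
  set z := ∑ j, ψ (a j) x - (K : ℂ) * ∑ i, (w i : ℂ) * ψ i x with hz
  have hb : ∀ b, (σ b * z).re ≤ K * (ε / 2) := fun b => by
    refine le_trans (le_of_eq ?_) (ha (x, b))
    have : σ b * z = ∑ j, σ b * ψ (a j) x - (K : ℝ) * ∑ i, (w i : ℂ) * (σ b * ψ i x) := by
      rw [hz, mul_sub, Finset.mul_sum, ← mul_assoc, mul_comm (σ b) (K : ℂ), mul_assoc,
        Finset.mul_sum]
      push_cast
      congr 2
      exact Finset.sum_congr rfl fun i _ => by ring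
    rw [this, Complex.sub_re, Complex.re_sum, Complex.re_ofReal_mul, Complex.re_sum]
    simp only [Complex.re_ofReal_mul]
  have h0 := hb 0
  have h1 := hb 1
  have h2 := hb 2
  have h3 := hb 3
  simp [σ] at h0 h1 h2 h3
  have hzn : ‖z‖ ≤ K * ε := by
    refine (Complex.norm_le_abs_re_add_abs_im z).trans ?_
    have hr : |z.re| ≤ K * (ε / 2) := abs_le.2 ⟨by linarith, h0⟩
    have hi : |z.im| ≤ K * (ε / 2) := abs_le.2 ⟨by linarith, h3⟩
    linarith
  have hKc : (K : ℂ) ≠ 0 := by exact_mod_cast hK0.ne'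
  have : ∑ i, (w i : ℂ) * ψ i x - (K : ℂ)⁻¹ * ∑ j, ψ (a j) x = -((K : ℂ)⁻¹ * z) := by
    rw [hz, mul_sub, ← mul_assoc, inv_mul_cancel₀ hKc]; ring
  rw [this, norm_neg, norm_mul, norm_inv, Complex.norm_natCast]
  rwa [inv_mul_le_iff₀ hKr]

/-- Random points hit every member of a family of sets that are large compared with the
cardinality of the family. -/
theorem exists_hitting_points {G τ : Type*} [Fintype G] [Nonempty G] [DecidableEq G]
    (I : Finset τ) (A : τ → Finset G) (m : ℕ)
    (h : ∑ i ∈ I, (1 - ((A i).card : ℝ) / Fintype.card G) ^ m < 1) :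
    ∃ t : Fin m → G, ∀ i ∈ I, ∃ l, t l ∈ A i := by
  classical
  by_contra! hcon
  have hG : (0 : ℝ) < Fintype.card G := by exact_mod_cast Fintype.card_pos
  have hsub : (Finset.univ : Finset (Fin m → G)) ⊆
      I.biUnion fun i => Fintype.piFinset fun _ => (A i)ᶜ := fun t _ => by
    obtain ⟨i, hi, ht⟩ := hcon t
    simp only [Finset.mem_biUnion, Fintype.mem_piFinset, Finset.mem_compl]
    exact ⟨i, hi, ht⟩
  have hcard := (Finset.card_le_card hsub).trans Finset.card_biUnion_le
  simp only [Finset.card_univ, Fintype.card_fun, Fintype.card_fin, Fintype.card_piFinset,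
    Finset.prod_const, Finset.card_compl] at hcard
  have hcard' : (Fintype.card G : ℝ) ^ m ≤
      ∑ i ∈ I, (Fintype.card G - (A i).card : ℝ) ^ m := by
    have : ((Fintype.card G ^ m : ℕ) : ℝ) ≤
        ((∑ i ∈ I, (Fintype.card G - (A i).card) ^ m : ℕ) : ℝ) := by exact_mod_cast hcard
    push_cast at this
    refine this.trans (le_of_eq (Finset.sum_congr rfl fun i _ => ?_))
    rw [Nat.cast_sub (Finset.card_le_univ _)]
  have heq : ∑ i ∈ I, (Fintype.card G - (A i).card : ℝ) ^ m =
      (Fintype.card G : ℝ) ^ m * ∑ i ∈ I, (1 - ((A i).card : ℝ) / Fintype.card G) ^ m := by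
    rw [Finset.mul_sum]
    refine Finset.sum_congr rfl fun i _ => ?_
    rw [← mul_pow, mul_sub, mul_one, mul_div_cancel₀ _ hG.ne']
  rw [heq] at hcard'
  nlinarith [pow_pos hG m]

theorem le_sum_dyadic_levels {y : ℝ} (hy1 : y ≤ 1) (J : ℕ) :
    y ≤ ∑ j ∈ Finset.range J, (1 / 2 : ℝ) ^ j * (if (1 / 2 : ℝ) ^ (j + 1) ≤ y then 1 else 0) +
      (1 / 2) ^ J := by
  induction J with
  | zero => simpa using hy1
  | succ J ih =>
    rw [Finset.sum_range_succ]
    have hs : 0 ≤ ∑ j ∈ Finset.range J,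
        (1 / 2 : ℝ) ^ j * (if (1 / 2 : ℝ) ^ (j + 1) ≤ y then 1 else 0) :=
      Finset.sum_nonneg fun j _ => by positivity
    have hp : (0 : ℝ) < (1 / 2) ^ (J + 1) := by positivity
    split_ifs with h
    · linarith
    · linarith [not_le.1 h]

/-- Some dyadic level set of a bounded function with large mean square is large. -/
theorem exists_large_level {G : Type*} [Fintype G] [Nonempty G] (F : G → ℝ)
    (hF1 : ∀ x, F x ≤ 1) {J : ℕ} (hJ : 1 ≤ J) {D : ℝ} (hJD : (1 / 2 : ℝ) ^ J ≤ D / 2)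
    (hD : D * Fintype.card G ≤ ∑ x, F x) :
    ∃ j < J, 2 ^ j * D / (2 * J) * Fintype.card G ≤
      ((Finset.univ.filter fun x => (1 / 2 : ℝ) ^ (j + 1) ≤ F x).card : ℝ) := by
  by_contra! hcon
  have hG : (0 : ℝ) < Fintype.card G := by exact_mod_cast Fintype.card_pos
  have hJr : (0 : ℝ) < J := by exact_mod_cast hJ
  have h1 : ∑ x, F x ≤ ∑ j ∈ Finset.range J, (1 / 2 : ℝ) ^ j *
      ((Finset.univ.filter fun x => (1 / 2 : ℝ) ^ (j + 1) ≤ F x).card : ℝ) +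
      (1 / 2) ^ J * Fintype.card G := by
    refine (Finset.sum_le_sum fun x _ => le_sum_dyadic_levels (hF1 x) J).trans ?_
    rw [Finset.sum_add_distrib, Finset.sum_comm]
    refine le_of_eq (congrArg₂ _ (Finset.sum_congr rfl fun j _ => ?_) ?_)
    · rw [← Finset.mul_sum, Finset.sum_boole]
    · rw [Finset.sum_const, Finset.card_univ, nsmul_eq_mul, mul_comm]
  have h2 : ∑ j ∈ Finset.range J, (1 / 2 : ℝ) ^ j *
      ((Finset.univ.filter fun x => (1 / 2 : ℝ) ^ (j + 1) ≤ F x).card : ℝ) <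
      ∑ j ∈ Finset.range J, D / (2 * J) * Fintype.card G := by
    refine Finset.sum_lt_sum_of_nonempty (Finset.nonempty_range_iff.2 (by omega)) fun j hj => ?_
    have := mul_lt_mul_of_pos_left (hcon j (Finset.mem_range.1 hj))
      (show (0 : ℝ) < (1 / 2) ^ j by positivity)
    refine this.trans_eq ?_
    have : (1 / 2 : ℝ) ^ j * 2 ^ j = 1 := by rw [← mul_pow]; norm_num
    linear_combination (D / (2 * J) * Fintype.card G) * this
  have h3 : ∑ j ∈ Finset.range J, D / (2 * J) * Fintype.card G = D / 2 * Fintype.card G := by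
    rw [Finset.sum_const, Finset.card_range, nsmul_eq_mul]; field_simp
  nlinarith

/-- Points at which every convex combination of the dictionary with large mean square is
not small. -/
theorem exists_points_convex {κ G : Type*} [Fintype κ] [Fintype G] [Nonempty G] (ψ : κ → G → ℂ)
    (hψ : ∀ i x, ‖ψ i x‖ ≤ 1) {J P m : ℕ} (hJ : 1 ≤ J) (hJP : J ≤ P)
    (hG : 4 * (Fintype.card G : ℝ) ≤ exp P) (hκ : (Fintype.card κ : ℝ) ≤ exp P)
    {D : ℝ} (hD : 5000 * J * (P : ℝ) ^ 2 ≤ m * D) (hJD : (1 / 2 : ℝ) ^ J ≤ D / 2) :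
    ∃ t : Fin m → G, ∀ w : κ → ℝ, (∀ i, 0 ≤ w i) → ∑ i, w i = 1 →
      D * Fintype.card G ≤ ∑ x, ‖∑ i, (w i : ℂ) * ψ i x‖ ^ 2 →
      ∃ l, (1 / 2 : ℝ) ^ J / 4 ≤ ‖∑ i, (w i : ℂ) * ψ i (t l)‖ ^ 2 := by
  classical
  have hGpos : (0 : ℝ) < Fintype.card G := by exact_mod_cast Fintype.card_pos
  have hJr : (1 : ℝ) ≤ J := by exact_mod_cast hJ
  have hPr : (1 : ℝ) ≤ P := by exact_mod_cast hJ.trans hJP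
  let K : ℕ → ℕ := fun j => 2048 * 2 ^ j * P
  let α : ℕ → ℝ := fun j => √((1 / 2) ^ (j + 1))
  have hα : ∀ j, α j ^ 2 = (1 / 2) ^ (j + 1) := fun j => Real.sq_sqrt (by positivity)
  have hα0 : ∀ j, 0 < α j := fun j => Real.sqrt_pos.2 (by positivity)
  have h2j : ∀ j, (1 / 2 : ℝ) ^ (j + 1) * 2 ^ j = 1 / 2 := fun j => by
    rw [pow_succ, mul_right_comm, ← mul_pow]; norm_num
  let g : (Σ j : Fin J, Fin (K j) → κ) → G → ℂ := fun p x => (K p.1 : ℂ)⁻¹ * ∑ j, ψ (p.2 j) x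
  let A : (Σ j : Fin J, Fin (K j) → κ) → Finset G := fun p =>
    Finset.univ.filter fun x => 3 / 4 * α p.1 ≤ ‖g p x‖
  let I : Finset (Σ j : Fin J, Fin (K j) → κ) := Finset.univ.filter fun p =>
    2 ^ (p.1 : ℕ) * D / (2 * J) * Fintype.card G ≤ ((A p).card : ℝ)
  have hsum : ∑ p ∈ I, (1 - ((A p).card : ℝ) / Fintype.card G) ^ m < 1 := by
    have hterm : ∀ p ∈ I, (1 - ((A p).card : ℝ) / Fintype.card G) ^ m ≤
        exp (-(2500 * 2 ^ (p.1 : ℕ) * (P : ℝ) ^ 2)) := fun p hp => by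
      have hp' := (Finset.mem_filter.1 hp).2
      have hq1 : ((A p).card : ℝ) / Fintype.card G ≤ 1 := by
        rw [div_le_one hGpos]; exact_mod_cast Finset.card_le_univ _
      have hq2 : 2 ^ (p.1 : ℕ) * D / (2 * J) ≤ ((A p).card : ℝ) / Fintype.card G := by
        rwa [le_div_iff₀ hGpos]
      have hq3 : 2500 * 2 ^ (p.1 : ℕ) * (P : ℝ) ^ 2 ≤ m * (((A p).card : ℝ) / Fintype.card G) := by
        refine le_trans ?_ (mul_le_mul_of_nonneg_left hq2 (Nat.cast_nonneg m))
        rw [mul_div_assoc', le_div_iff₀ (by positivity)]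
        nlinarith [mul_le_mul_of_nonneg_left hD (show (0 : ℝ) ≤ 2 ^ (p.1 : ℕ) by positivity)]
      calc (1 - ((A p).card : ℝ) / Fintype.card G) ^ m
          ≤ (exp (-(((A p).card : ℝ) / Fintype.card G))) ^ m :=
            pow_le_pow_left₀ (by linarith) (by
              linarith [add_one_le_exp (-(((A p).card : ℝ) / Fintype.card G))]) m
        _ = exp (-(m * (((A p).card : ℝ) / Fintype.card G))) := by
            rw [← exp_nat_mul]; congr 1; ring
        _ ≤ _ := exp_le_exp.2 (by linarith)
    calc ∑ p ∈ I, (1 - ((A p).card : ℝ) / Fintype.card G) ^ m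
        ≤ ∑ p ∈ I, exp (-(2500 * 2 ^ (p.1 : ℕ) * (P : ℝ) ^ 2)) := Finset.sum_le_sum hterm
      _ ≤ ∑ p : (Σ j : Fin J, Fin (K j) → κ), exp (-(2500 * 2 ^ (p.1 : ℕ) * (P : ℝ) ^ 2)) :=
          Finset.sum_le_sum_of_subset_of_nonneg (Finset.subset_univ _)
            fun _ _ _ => (exp_pos _).le
      _ = ∑ j : Fin J, (Fintype.card κ : ℝ) ^ (K j) *
            exp (-(2500 * 2 ^ (j : ℕ) * (P : ℝ) ^ 2)) := by
          rw [← Finset.univ_sigma_univ, Finset.sum_sigma]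
          refine Finset.sum_congr rfl fun j _ => ?_
          simp
      _ ≤ ∑ j : Fin J, exp (-P) := by
          refine Finset.sum_le_sum fun j _ => ?_
          have h1 : (Fintype.card κ : ℝ) ^ (K j) ≤ exp (2048 * 2 ^ (j : ℕ) * (P : ℝ) ^ 2) := by
            refine (pow_le_pow_left₀ (Nat.cast_nonneg _) hκ _).trans (le_of_eq ?_)
            rw [← exp_nat_mul]; congr 1; simp only [K]; push_cast; ring
          refine (mul_le_mul_of_nonneg_right h1 (exp_pos _).le).trans ?_
          rw [← exp_add]
          refine exp_le_exp.2 ?_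
          have h2 : (1 : ℝ) ≤ 2 ^ (j : ℕ) := one_le_pow₀ (by norm_num)
          nlinarith [mul_le_mul h2 (show (P : ℝ) ≤ (P : ℝ) ^ 2 by nlinarith)
            (by positivity) (by positivity)]
      _ = J * exp (-P) := by simp
      _ < 1 := by
          have h1 : (J : ℝ) ≤ P := by exact_mod_cast hJP
          have h2 := add_one_le_exp (P : ℝ)
          rw [exp_neg, ← div_eq_mul_inv, div_lt_one (exp_pos _)]
          linarith
  obtain ⟨t, ht⟩ := exists_hitting_points I A m hsum
  refine ⟨t, fun w hw hw1 hF => ?_⟩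
  set F : G → ℂ := fun x => ∑ i, (w i : ℂ) * ψ i x with hFdef
  have hF1 : ∀ x, ‖F x‖ ≤ 1 := fun x => by
    refine (norm_sum_le _ _).trans (le_trans (Finset.sum_le_sum fun i _ => ?_) hw1.le)
    rw [norm_mul, Complex.norm_real, Real.norm_of_nonneg (hw i)]
    exact mul_le_of_le_one_right (hw i) (hψ i x)
  obtain ⟨j, hjJ, hj⟩ := exists_large_level (fun x => ‖F x‖ ^ 2)
    (fun x => pow_le_one₀ (norm_nonneg _) (hF1 x)) hJ hJD hF
  have hα1 : α j ≤ 1 := Real.sqrt_le_one.2 (pow_le_one₀ (by norm_num) (by norm_num))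
  obtain ⟨a, ha⟩ := maurey_complex ψ hψ w hw hw1 (ε := α j / 4) (K := K j)
    (by linarith [hα0 j]) (by linarith) (mul_pos (by positivity) (by omega)) (by
      have h1 : Real.log (4 * Fintype.card G) ≤ P :=
        (Real.log_le_iff_le_exp (by positivity)).2 hG
      rw [div_pow, hα]
      simp only [K]; push_cast
      have := h2j j
      have h3 : 2048 * 2 ^ j * (P : ℝ) * ((1 / 2) ^ (j + 1) / 4 ^ 2) = 64 * P := by
        linear_combination (2048 * P / 16) * this
      rw [h3]; linarith)
  have hsub : (Finset.univ.filter fun x => (1 / 2 : ℝ) ^ (j + 1) ≤ ‖F x‖ ^ 2) ⊆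
      A ⟨⟨j, hjJ⟩, a⟩ := fun x hx => by
    have hx' := (Finset.mem_filter.1 hx).2
    rw [← hα, sq_le_sq₀ (hα0 j).le (norm_nonneg _)] at hx'
    refine Finset.mem_filter.2 ⟨Finset.mem_univ _, ?_⟩
    have h1 : ‖F x‖ - ‖g ⟨⟨j, hjJ⟩, a⟩ x‖ ≤ α j / 4 := (norm_sub_norm_le _ _).trans (ha x)
    change 3 / 4 * α j ≤ _
    linarith
  obtain ⟨l, hl⟩ := ht ⟨⟨j, hjJ⟩, a⟩ (Finset.mem_filter.2 ⟨Finset.mem_univ _,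
    hj.trans (by exact_mod_cast Finset.card_le_card hsub)⟩)
  refine ⟨l, ?_⟩
  have h1 : 3 / 4 * α j ≤ ‖g ⟨⟨j, hjJ⟩, a⟩ (t l)‖ := (Finset.mem_filter.1 hl).2
  have h2 : ‖g ⟨⟨j, hjJ⟩, a⟩ (t l)‖ - ‖F (t l)‖ ≤ α j / 4 := by
    refine (norm_sub_norm_le _ _).trans ?_
    rw [norm_sub_rev]; exact ha (t l)
  have h3 : α j / 2 ≤ ‖F (t l)‖ := by linarith
  have h4 : (α j / 2) ^ 2 ≤ ‖F (t l)‖ ^ 2 := pow_le_pow_left₀ (by linarith [hα0 j]) h3 2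
  rw [div_pow, hα] at h4
  have h5 : (1 / 2 : ℝ) ^ J ≤ (1 / 2) ^ (j + 1) :=
    pow_le_pow_of_le_one (by norm_num) (by norm_num) hjJ
  change _ ≤ ‖F (t l)‖ ^ 2
  linarith

theorem exists_weights_half (z : ℂ) : ∃ v : Fin 5 → ℝ, (∀ a, 0 ≤ v a) ∧ ∑ a, v a = ‖z‖ ∧
    ∑ a, (v a : ℂ) * (![1, -1, Complex.I, -Complex.I, 0] : Fin 5 → ℂ) a = z / 2 := by
  have hr := Complex.abs_re_le_norm z
  have hi := Complex.abs_im_le_norm z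
  have h1 : ∀ x : ℝ, max x 0 + max (-x) 0 = |x| := fun x => by
    rcases le_total 0 x with h | h
    · rw [max_eq_left h, max_eq_right (by linarith), abs_of_nonneg h, add_zero]
    · rw [max_eq_right h, max_eq_left (by linarith), abs_of_nonpos h, zero_add]
  have h2 : ∀ x : ℝ, max x 0 - max (-x) 0 = x := fun x => by
    rcases le_total 0 x with h | h
    · rw [max_eq_left h, max_eq_right (by linarith), sub_zero]
    · rw [max_eq_right h, max_eq_left (by linarith)]; ring
  refine ⟨![max z.re 0 / 2, max (-z.re) 0 / 2, max z.im 0 / 2, max (-z.im) 0 / 2,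
    ‖z‖ - (|z.re| + |z.im|) / 2], ?_, ?_, ?_⟩
  · intro a
    fin_cases a
    · exact div_nonneg (le_max_right _ _) zero_le_two
    · exact div_nonneg (le_max_right _ _) zero_le_two
    · exact div_nonneg (le_max_right _ _) zero_le_two
    · exact div_nonneg (le_max_right _ _) zero_le_two
    · change 0 ≤ ‖z‖ - (|z.re| + |z.im|) / 2
      linarith
  · simp only [Fin.sum_univ_five, Matrix.cons_val]
    linarith [h1 z.re, h1 z.im]
  · simp only [Fin.sum_univ_five, Matrix.cons_val]
    have h3 := h2 z.re
    have h4 := h2 z.im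
    apply Complex.ext
    · simp
      linarith
    · simp
      linarith

/-- Points at which a sum with small values has either small mean square, compared with the
absolute sum of its coefficients, or small coefficients. -/
theorem exists_points_coeff {ι G : Type*} [Fintype ι] [Fintype G] [Nonempty G] (φ : ι → G → ℂ)
    (hφ : ∀ i x, ‖φ i x‖ ≤ 1) {J P m : ℕ} (hJ : 1 ≤ J) (hJP : J ≤ P)
    (hG : 4 * (Fintype.card G : ℝ) ≤ exp P) (hι : 5 * (Fintype.card ι : ℝ) ≤ exp P)
    {D : ℝ} (hD : 20000 * J * (P : ℝ) ^ 2 ≤ m * D) (hJD : (1 / 2 : ℝ) ^ J ≤ D / 8) :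
    ∃ t : Fin m → G, ∀ (c : ι → ℂ) (η : ℝ), (∀ l, ‖∑ i, c i * φ i (t l)‖ ≤ η) →
      ∑ x, ‖∑ i, c i * φ i x‖ ^ 2 ≤ D * (∑ i, ‖c i‖) ^ 2 * Fintype.card G ∨
      (∑ i, ‖c i‖) ^ 2 ≤ 2 ^ J * η ^ 2 := by
  let u : Fin 5 → ℂ := ![1, -1, Complex.I, -Complex.I, 0]
  have hu : ∀ a, ‖u a‖ ≤ 1 := by intro a; fin_cases a <;> simp [u]
  obtain ⟨t, ht⟩ := exists_points_convex (κ := ι × Fin 5) (m := m)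
    (fun p x => u p.2 * φ p.1 x)
    (fun p x => by rw [norm_mul]; exact mul_le_one₀ (hu _) (norm_nonneg _) (hφ _ _)) hJ hJP hG
    (by rw [Fintype.card_prod, Fintype.card_fin]; push_cast; linarith)
    (D := D / 4) (by linarith) (by linarith)
  refine ⟨t, fun c η hη => ?_⟩
  set W := ∑ i, ‖c i‖ with hW
  have hW0 : 0 ≤ W := Finset.sum_nonneg fun i _ => norm_nonneg (c i)
  rcases hW0.eq_or_lt with h0 | hpos
  · right
    rw [← h0, zero_pow two_ne_zero]; positivity
  choose v hv0 hv1 hv2 using fun i => exists_weights_half (c i)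
  have hF : ∀ x, ∑ p : ι × Fin 5, ((v p.1 p.2 / W : ℝ) : ℂ) * (u p.2 * φ p.1 x) =
      (2 * W : ℂ)⁻¹ * ∑ i, c i * φ i x := fun x => by
    rw [Fintype.sum_prod_type, Finset.mul_sum]
    refine Finset.sum_congr rfl fun i _ => ?_
    have h1 : c i = 2 * ∑ a, (v i a : ℂ) * u a := by rw [hv2]; ring
    have hWc : (W : ℂ) ≠ 0 := by exact_mod_cast hpos.ne'
    rw [h1, Finset.mul_sum, Finset.sum_mul, Finset.mul_sum]
    refine Finset.sum_congr rfl fun a _ => ?_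
    push_cast
    field_simp
  have hn : ∀ x, ‖∑ p : ι × Fin 5, ((v p.1 p.2 / W : ℝ) : ℂ) * (u p.2 * φ p.1 x)‖ ^ 2 =
      (4 * W ^ 2)⁻¹ * ‖∑ i, c i * φ i x‖ ^ 2 := fun x => by
    rw [hF, norm_mul, norm_inv, mul_pow, norm_mul, Complex.norm_real, Real.norm_of_nonneg hpos.le]
    congr 1
    rw [Complex.norm_ofNat, inv_pow, mul_pow]; norm_num
  by_cases hlarge : D / 4 * Fintype.card G ≤
      ∑ x, ‖∑ p : ι × Fin 5, ((v p.1 p.2 / W : ℝ) : ℂ) * (u p.2 * φ p.1 x)‖ ^ 2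
  · right
    obtain ⟨l, hl⟩ := ht (fun p => v p.1 p.2 / W) (fun p => div_nonneg (hv0 _ _) hpos.le) (by
      rw [Fintype.sum_prod_type]
      simp only [← Finset.sum_div, hv1]
      exact div_self hpos.ne') hlarge
    rw [hn] at hl
    have h1 : ‖∑ i, c i * φ i (t l)‖ ^ 2 ≤ η ^ 2 := pow_le_pow_left₀ (norm_nonneg _) (hη l) 2
    have h2 : (1 / 2 : ℝ) ^ J * W ^ 2 ≤ η ^ 2 := by
      rw [← div_eq_inv_mul, le_div_iff₀ (by positivity)] at hl
      linarith
    have h3 : (2 : ℝ) ^ J * (1 / 2) ^ J = 1 := by rw [← mul_pow]; norm_num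
    calc W ^ 2 = 2 ^ J * ((1 / 2) ^ J * W ^ 2) := by rw [← mul_assoc, h3, one_mul]
      _ ≤ _ := mul_le_mul_of_nonneg_left h2 (by positivity)
  · left
    simp only [hn, ← Finset.mul_sum] at hlarge
    have := (not_le.1 hlarge).le
    rw [← div_eq_inv_mul, div_le_iff₀ (by positivity)] at this
    linarith

theorem norm_expk (d : ℕ) (k : Fin d → ℤ) (x : Fin d → ℝ) : ‖expk d k x‖ = 1 :=
  Complex.norm_exp_ofReal_mul_I _

theorem expk_eq_prod (d : ℕ) (k : Fin d → ℤ) (x : Fin d → ℝ) :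
    expk d k x = ∏ i, Complex.exp (((2 * π * ((k i : ℝ) * x i) : ℝ) : ℂ) * Complex.I) := by
  rw [expk, ← Complex.exp_sum, ← Finset.sum_mul, Finset.mul_sum]
  push_cast
  rfl

theorem expk_mul_conj (d : ℕ) (k l : Fin d → ℤ) (x : Fin d → ℝ) :
    expk d k x * (starRingEnd ℂ) (expk d l x) = expk d (k - l) x := by
  rw [expk, expk, expk, ← Complex.exp_conj, ← Complex.exp_add]
  congr 1
  simp only [map_mul, Complex.conj_ofReal, Complex.conj_I, Pi.sub_apply]
  rw [mul_neg, ← sub_eq_add_neg, ← sub_mul, ← Complex.ofReal_sub, ← mul_sub,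
    ← Finset.sum_sub_distrib]
  refine congrArg (fun y : ℝ => ((2 * π * y : ℝ) : ℂ) * Complex.I) (Finset.sum_congr rfl fun i _ => ?_)
  rw [Int.cast_sub, sub_mul]

/-- Equispaced points of the cube. -/
def gridPoint (d Q : ℕ) (g : Fin d → Fin Q) : Fin d → ℝ := fun i => (g i : ℝ) / Q

theorem gridPoint_mem_cube (d Q : ℕ) (g : Fin d → Fin Q) : gridPoint d Q g ∈ cube d := by
  intro i _
  have hQ : (0 : ℝ) < Q := by exact_mod_cast (Nat.zero_le _).trans_lt (g i).2
  refine ⟨by unfold gridPoint; positivity, ?_⟩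
  simp only [gridPoint]
  rw [div_lt_one hQ]
  exact_mod_cast (g i).2

theorem sum_exp_grid {Q : ℕ} {l : ℤ} (hl : l ≠ 0) (hlQ : |l| < Q) :
    ∑ j : Fin Q, Complex.exp (((2 * π * ((l : ℝ) * ((j : ℝ) / Q)) : ℝ) : ℂ) * Complex.I) = 0 := by
  have hQ : 0 < Q := by
    have := abs_nonneg l
    omega
  have hQc : (Q : ℂ) ≠ 0 := by exact_mod_cast hQ.ne'
  set ω := Complex.exp (2 * π * Complex.I * (l / Q)) with hω
  have h1 : ∀ j : ℕ, Complex.exp (((2 * π * ((l : ℝ) * ((j : ℝ) / Q)) : ℝ) : ℂ) * Complex.I) =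
      ω ^ j := fun j => by
    rw [hω, ← Complex.exp_nat_mul]
    congr 1
    push_cast; ring
  simp only [h1]
  rw [Fin.sum_univ_eq_sum_range fun j => ω ^ j]
  have hne : ω ≠ 1 := fun h => by
    rw [hω, Complex.exp_eq_one_iff] at h
    obtain ⟨n, hn⟩ := h
    have h2 : (2 * π * Complex.I : ℂ) ≠ 0 := Complex.two_pi_I_ne_zero
    have h3 : (l : ℂ) / Q = n := by
      apply mul_left_cancel₀ h2
      rw [hn]; ring
    rw [div_eq_iff hQc] at h3
    have h4 : l = n * Q := by exact_mod_cast h3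
    rw [h4, abs_mul, Nat.abs_cast] at hlQ
    have h5 : |n| < 1 := by
      by_contra! h
      nlinarith
    rw [Int.abs_lt_one_iff] at h5
    simp [h5] at h4
    exact hl h4
  have hpow : ω ^ Q = 1 := by
    rw [hω, ← Complex.exp_nat_mul, Complex.exp_eq_one_iff]
    exact ⟨l, by field_simp⟩
  rw [geom_sum_eq hne, hpow, sub_self, zero_div]

theorem sum_expk_grid {d Q : ℕ} {k : Fin d → ℤ} (hk : k ≠ 0) (hkQ : ∀ i, |k i| < Q) :
    ∑ g, expk d k (gridPoint d Q g) = 0 := by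
  classical
  obtain ⟨i, hi⟩ := Function.ne_iff.1 hk
  simp only [expk_eq_prod, gridPoint]
  rw [← Fintype.prod_sum fun i (j : Fin Q) =>
    Complex.exp (((2 * π * ((k i : ℝ) * ((j : ℝ) / Q)) : ℝ) : ℂ) * Complex.I)]
  exact Finset.prod_eq_zero (Finset.mem_univ i) (sum_exp_grid hi (hkQ i))

/-- The frequencies in `[-M,M]^d`. -/
def box (d M : ℕ) : Finset (Fin d → ℤ) := Fintype.piFinset fun _ => Finset.Icc (-(M : ℤ)) M

theorem card_box (d M : ℕ) : (box d M).card = (2 * M + 1) ^ d := by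
  rw [box, Fintype.card_piFinset]
  simp only [Int.card_Icc, Finset.prod_const, Finset.card_univ, Fintype.card_fin]
  congr 1
  omega

theorem sum_grid_norm_sq (d M : ℕ) (c : (Fin d → ℤ) → ℂ) :
    ∑ g, ‖∑ k ∈ box d M, c k * expk d k (gridPoint d (2 * M + 1) g)‖ ^ 2 =
      (2 * M + 1) ^ d * ∑ k ∈ box d M, ‖c k‖ ^ 2 := by
  have hker : ∀ k ∈ box d M, ∀ l ∈ box d M,
      ∑ g, expk d (k - l) (gridPoint d (2 * M + 1) g) =
        if k = l then ((2 * M + 1 : ℂ)) ^ d else 0 := fun k hk l hl => by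
    split_ifs with h
    · simp [h, expk]
    · refine sum_expk_grid (sub_ne_zero.2 h) fun i => ?_
      have h1 := Finset.mem_Icc.1 (Fintype.mem_piFinset.1 hk i)
      have h2 := Finset.mem_Icc.1 (Fintype.mem_piFinset.1 hl i)
      rw [Pi.sub_apply, abs_lt]
      push_cast
      constructor <;> linarith
  have hc : ((∑ g, ‖∑ k ∈ box d M, c k * expk d k (gridPoint d (2 * M + 1) g)‖ ^ 2 : ℝ) : ℂ) =
      (((2 * M + 1) ^ d * ∑ k ∈ box d M, ‖c k‖ ^ 2 : ℝ) : ℂ) := by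
    push_cast
    simp only [← Complex.mul_conj', map_sum, map_mul, Finset.sum_mul_sum]
    rw [Finset.sum_comm, Finset.mul_sum]
    refine Finset.sum_congr rfl fun k hk => ?_
    rw [Finset.sum_comm]
    have : ∀ l ∈ box d M, ∑ g, c k * expk d k (gridPoint d (2 * M + 1) g) *
        ((starRingEnd ℂ) (c l) * (starRingEnd ℂ) (expk d l (gridPoint d (2 * M + 1) g))) =
        if k = l then (2 * M + 1 : ℂ) ^ d * (c k * (starRingEnd ℂ) (c l)) else 0 := fun l hl => by
      have h1 : ∀ g, c k * expk d k (gridPoint d (2 * M + 1) g) *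
          ((starRingEnd ℂ) (c l) * (starRingEnd ℂ) (expk d l (gridPoint d (2 * M + 1) g))) =
          c k * (starRingEnd ℂ) (c l) * expk d (k - l) (gridPoint d (2 * M + 1) g) := fun g => by
        rw [← expk_mul_conj]; ring
      simp only [h1]
      rw [← Finset.mul_sum, hker k hk l hl]
      split_ifs <;> ring
    rw [Finset.sum_congr rfl this]
    simp [hk]
  exact_mod_cast hc

/-- Sampling points for trigonometric polynomials with frequencies in a box. -/
theorem exists_sampling_points (d M : ℕ) {J P m : ℕ} (hJ : 1 ≤ J) (hJP : J ≤ P)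
    (hP : 5 * (2 * M + 1 : ℝ) ^ d ≤ exp P)
    {D : ℝ} (hD : 20000 * J * (P : ℝ) ^ 2 ≤ m * D) (hJD : (1 / 2 : ℝ) ^ J ≤ D / 8) :
    ∃ t : Fin m → Fin d → ℝ, (∀ l, t l ∈ cube d) ∧ ∀ (c : (Fin d → ℤ) → ℂ) (η : ℝ),
      (∀ l, ‖∑ k ∈ box d M, c k * expk d k (t l)‖ ≤ η) →
      ∑ k ∈ box d M, ‖c k‖ ^ 2 ≤ D * (∑ k ∈ box d M, ‖c k‖) ^ 2 ∨
      (∑ k ∈ box d M, ‖c k‖) ^ 2 ≤ 2 ^ J * η ^ 2 := by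
  have hpos : (0 : ℝ) < (2 * M + 1 : ℝ) ^ d := by positivity
  obtain ⟨t, ht⟩ := exists_points_coeff (ι := box d M) (G := Fin d → Fin (2 * M + 1)) (m := m)
    (fun k g => expk d k (gridPoint d (2 * M + 1) g)) (fun k g => (norm_expk _ _ _).le) hJ hJP
    (by simp only [Fintype.card_fun, Fintype.card_fin]; push_cast; linarith)
    (by rw [Fintype.card_coe, card_box]; push_cast; linarith) hD hJD
  refine ⟨fun l => gridPoint d (2 * M + 1) (t l), fun l => gridPoint_mem_cube _ _ _,
    fun c η hη => ?_⟩
  have hs : ∀ (f : (Fin d → ℤ) → ℂ), ∑ k : box d M, f k = ∑ k ∈ box d M, f k :=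
    fun f => Finset.sum_coe_sort (box d M) f
  have hs' : ∀ (f : (Fin d → ℤ) → ℝ), ∑ k : box d M, f k = ∑ k ∈ box d M, f k :=
    fun f => Finset.sum_coe_sort (box d M) f
  have := ht (fun k => c k) η (fun l => by
    rw [hs fun k => c k * expk d k (gridPoint d (2 * M + 1) (t l))]; exact hη l)
  rw [hs' fun k => ‖c k‖] at this
  refine this.imp_left fun h => ?_
  have h1 : ∀ g, ∑ k : box d M, c k * expk d k (gridPoint d (2 * M + 1) g) =
      ∑ k ∈ box d M, c k * expk d k (gridPoint d (2 * M + 1) g) := fun g =>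
    hs fun k => c k * expk d k (gridPoint d (2 * M + 1) g)
  simp only [h1, sum_grid_norm_sq, Fintype.card_fun, Fintype.card_fin] at h
  push_cast at h
  refine le_of_mul_le_mul_left (h.trans_eq (mul_comm _ _)) hpos

theorem wt_pos (d : ℕ) (k : Fin d → ℤ) : 0 < wt d k :=
  Finset.prod_pos fun i _ => by positivity

theorem one_add_abs_le_wt (d : ℕ) (k : Fin d → ℤ) (i : Fin d) : 1 + |(k i : ℝ)| ≤ wt d k := by
  classical
  rw [wt, ← Finset.mul_prod_erase _ _ (Finset.mem_univ i)]
  refine le_mul_of_one_le_right (by positivity) ?_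
  exact Finset.prod_const_one.symm.trans_le (Finset.prod_le_prod (fun _ _ => zero_le_one)
    fun i _ => by linarith [abs_nonneg (k i : ℝ)])

theorem sum_int_le_two_mul_sum (A : Finset ℤ) {N : ℕ} (hA : ∀ a ∈ A, a.natAbs + 1 ≤ N)
    (f : ℕ → ℝ) (hf : ∀ n, 0 ≤ f n) :
    ∑ a ∈ A, f (a.natAbs + 1) ≤ 2 * ∑ b ∈ Finset.Icc 1 N, f b := by
  classical
  rw [← Finset.sum_fiberwise_of_maps_to (t := Finset.Icc 1 N) (g := fun a : ℤ => a.natAbs + 1)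
    (fun a ha => Finset.mem_Icc.2 ⟨by omega, hA a ha⟩), Finset.mul_sum]
  refine Finset.sum_le_sum fun b _ => ?_
  have hcard : (A.filter fun a : ℤ => a.natAbs + 1 = b).card ≤ 2 := by
    refine (Finset.card_le_card (t := {(b : ℤ) - 1, -((b : ℤ) - 1)}) fun a ha => ?_).trans
      Finset.card_le_two
    have := (Finset.mem_filter.1 ha).2
    simp only [Finset.mem_insert, Finset.mem_singleton]
    omega
  rw [Finset.sum_congr rfl fun a ha => by rw [(Finset.mem_filter.1 ha).2], Finset.sum_const,
    nsmul_eq_mul]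
  exact mul_le_mul_of_nonneg_right (by exact_mod_cast hcard) (hf b)

theorem natAbs_add_one_le_floor {a : ℤ} {T : ℝ} (h : 1 + |(a : ℝ)| ≤ T) :
    a.natAbs + 1 ≤ ⌊T⌋₊ := by
  refine Nat.le_floor ?_
  push_cast
  rw [Nat.cast_natAbs]
  push_cast
  linarith

/-- Cardinality of hyperbolic crosses. -/
theorem card_cross_le (n : ℕ) {T : ℝ} (hT : 1 ≤ T) (F : Finset (Fin (n + 1) → ℤ))
    (hF : ∀ k ∈ F, wt (n + 1) k ≤ T) :
    (F.card : ℝ) ≤ 2 ^ (n + 1) * T * (1 + Real.log T) ^ n := by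
  classical
  induction n generalizing T with
  | zero =>
    have hinj : Set.InjOn (fun k : Fin 1 → ℤ => k 0) F := fun k _ l _ h => by
      ext i; rw [Subsingleton.elim i 0]; exact h
    rw [← Finset.card_image_of_injOn hinj]
    have := sum_int_le_two_mul_sum (F.image fun k => k 0) (N := ⌊T⌋₊) (fun a ha => by
      obtain ⟨k, hk, rfl⟩ := Finset.mem_image.1 ha
      exact natAbs_add_one_le_floor ((one_add_abs_le_wt _ k 0).trans (hF k hk)))
      (fun _ => 1) (fun _ => zero_le_one)
    simp only [Finset.sum_const, nsmul_eq_mul, mul_one, Nat.card_Icc, Nat.add_sub_cancel] at this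
    have h2 := Nat.floor_le (zero_le_one.trans hT)
    simp only [zero_add, pow_one, pow_zero, mul_one]
    linarith
  | succ n ih =>
    have hlog : 0 ≤ Real.log T := Real.log_nonneg hT
    set A := F.image fun k => k 0 with hA
    have hA1 : ∀ a ∈ A, 1 + |(a : ℝ)| ≤ T := fun a ha => by
      obtain ⟨k, hk, rfl⟩ := Finset.mem_image.1 ha
      exact (one_add_abs_le_wt _ k 0).trans (hF k hk)
    have hfib : ∀ a ∈ A, ((F.filter fun k => k 0 = a).card : ℝ) ≤
        2 ^ (n + 1) * T * (1 + Real.log T) ^ n * (((a.natAbs + 1 : ℕ) : ℝ))⁻¹ := fun a ha => by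
      have hcast : (((a.natAbs + 1 : ℕ) : ℝ)) = 1 + |(a : ℝ)| := by
        push_cast; rw [Nat.cast_natAbs]; push_cast; ring
      have hpos : 0 < 1 + |(a : ℝ)| := by positivity
      have hinj : Set.InjOn (fun k : Fin (n + 2) → ℤ => Fin.tail k)
          (F.filter fun k => k 0 = a) := fun k hk l hl h => by
        rw [Finset.mem_coe, Finset.mem_filter] at hk hl
        rw [← Fin.cons_self_tail k, ← Fin.cons_self_tail l, hk.2, hl.2]
        exact congrArg _ h
      rw [← Finset.card_image_of_injOn hinj]
      have hT' : 1 ≤ T / (1 + |(a : ℝ)|) := by rw [one_le_div hpos]; exact hA1 a ha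
      have hle : T / (1 + |(a : ℝ)|) ≤ T :=
        div_le_self (by linarith) (by linarith [abs_nonneg (a : ℝ)])
      refine (ih hT' _ fun l hl => ?_).trans ?_
      · obtain ⟨k, hk, rfl⟩ := Finset.mem_image.1 hl
        rw [Finset.mem_filter] at hk
        have h1 := hF k hk.1
        rw [wt, Fin.prod_univ_succ, hk.2] at h1
        rw [le_div_iff₀ hpos, mul_comm]
        exact h1
      · rw [hcast]
        have h2 : (1 + Real.log (T / (1 + |(a : ℝ)|))) ^ n ≤ (1 + Real.log T) ^ n :=
          pow_le_pow_left₀ (by linarith [Real.log_nonneg hT'])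
            (by linarith [Real.log_le_log (by linarith) hle]) n
        calc _ ≤ 2 ^ (n + 1) * (T / (1 + |(a : ℝ)|)) * (1 + Real.log T) ^ n :=
              mul_le_mul_of_nonneg_left h2 (by positivity)
          _ = _ := by rw [div_eq_mul_inv]; ring
    have hharm : ∑ a ∈ A, (((a.natAbs + 1 : ℕ) : ℝ))⁻¹ ≤ 2 * (1 + Real.log T) := by
      refine (sum_int_le_two_mul_sum A (N := ⌊T⌋₊)
        (fun a ha => natAbs_add_one_le_floor (hA1 a ha)) (fun b => ((b : ℝ))⁻¹)
        (fun b => by positivity)).trans ?_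
      have := harmonic_floor_le_one_add_log T hT
      rw [harmonic_eq_sum_Icc] at this
      push_cast at this
      linarith
    have hcard : (F.card : ℝ) = ∑ a ∈ A, ((F.filter fun k => k 0 = a).card : ℝ) := by
      rw [Finset.card_eq_sum_card_image (fun k : Fin (n + 2) → ℤ => k 0) F]
      push_cast
      rfl
    rw [hcard]
    calc _ ≤ ∑ a ∈ A, 2 ^ (n + 1) * T * (1 + Real.log T) ^ n * (((a.natAbs + 1 : ℕ) : ℝ))⁻¹ :=
          Finset.sum_le_sum hfib
      _ = 2 ^ (n + 1) * T * (1 + Real.log T) ^ n * ∑ a ∈ A, (((a.natAbs + 1 : ℕ) : ℝ))⁻¹ := by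
          rw [Finset.mul_sum]
      _ ≤ 2 ^ (n + 1) * T * (1 + Real.log T) ^ n * (2 * (1 + Real.log T)) :=
          mul_le_mul_of_nonneg_left hharm (by positivity)
      _ = _ := by ring

theorem summable_add_two_pow_mul_geometric (n : ℕ) {ρ : ℝ} (h0 : 0 < ρ) (h1 : ρ < 1) :
    Summable fun j : ℕ => ((j : ℝ) + 2) ^ n * ρ ^ j := by
  have h := (summable_nat_add_iff 2).2 (summable_pow_mul_geometric_of_norm_lt_one (R := ℝ) n
    (r := ρ) (by rwa [Real.norm_of_nonneg h0.le]))
  refine (h.mul_left (ρ ^ 2)⁻¹).congr fun j => ?_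
  push_cast
  rw [pow_add]
  field_simp

/-- Power sums over the complement of a hyperbolic cross. -/
theorem exists_sum_wt_rpow_le (n : ℕ) {a : ℝ} (ha : 1 < a) : ∃ A : ℝ, 0 ≤ A ∧ ∀ T : ℝ, 1 ≤ T →
    ∀ F : Finset (Fin (n + 1) → ℤ), (∀ k ∈ F, T < wt (n + 1) k) →
      ∑ k ∈ F, (wt (n + 1) k / T) ^ (-a) ≤ A * (T * (1 + Real.log T) ^ n) := by
  classical
  set ρ : ℝ := 2 ^ (1 - a) with hρ
  have hρ0 : 0 < ρ := by positivity
  have hρ1 : ρ < 1 := Real.rpow_lt_one_of_one_lt_of_neg (by norm_num) (by linarith)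
  have hsum := summable_add_two_pow_mul_geometric n hρ0 hρ1
  refine ⟨2 ^ (n + 2) * ∑' j : ℕ, ((j : ℝ) + 2) ^ n * ρ ^ j,
    mul_nonneg (by positivity) (tsum_nonneg fun j => by positivity), fun T hT F hF => ?_⟩
  have hTpos : 0 < T := by linarith
  have hlog : 0 ≤ Real.log T := Real.log_nonneg hT
  let jj : (Fin (n + 1) → ℤ) → ℕ := fun k => Nat.log 2 ⌊wt (n + 1) k / T⌋₊
  have hj : ∀ k ∈ F, (2 : ℝ) ^ jj k ≤ wt (n + 1) k / T ∧ wt (n + 1) k / T ≤ 2 ^ (jj k + 1) :=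
    fun k hk => by
      have h1 : 1 ≤ wt (n + 1) k / T := by rw [one_le_div hTpos]; exact (hF k hk).le
      have h2 : ⌊wt (n + 1) k / T⌋₊ ≠ 0 := by
        rw [← Nat.pos_iff_ne_zero, Nat.floor_pos]; exact h1
      constructor
      · refine le_trans ?_ (Nat.floor_le (by linarith))
        exact_mod_cast Nat.pow_log_le_self 2 h2
      · refine (Nat.lt_floor_add_one _).le.trans ?_
        exact_mod_cast Nat.lt_pow_succ_log_self (by norm_num) _
  rw [← Finset.sum_fiberwise_of_maps_to (t := F.image jj) (g := jj)
    (fun k hk => Finset.mem_image_of_mem _ hk)]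
  have hfib : ∀ j, ∑ k ∈ F with jj k = j, (wt (n + 1) k / T) ^ (-a) ≤
      2 ^ (n + 2) * (T * (1 + Real.log T) ^ n) * (((j : ℝ) + 2) ^ n * ρ ^ j) := fun j => by
    have hT2 : 1 ≤ T * 2 ^ (j + 1) := by
      have : (1 : ℝ) ≤ 2 ^ (j + 1) := one_le_pow₀ (by norm_num)
      nlinarith
    have hcard := card_cross_le n hT2 (F.filter fun k => jj k = j) (fun k hk => by
      rw [Finset.mem_filter] at hk
      have := (hj k hk.1).2
      rw [hk.2, div_le_iff₀ hTpos] at this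
      linarith)
    have hlog2 : 1 + Real.log (T * 2 ^ (j + 1)) ≤ (1 + Real.log T) * (j + 2) := by
      rw [Real.log_mul hTpos.ne' (by positivity), Real.log_pow]
      have := Real.log_two_lt_d9
      push_cast
      nlinarith
    have hlog3 : 0 ≤ 1 + Real.log (T * 2 ^ (j + 1)) := by linarith [Real.log_nonneg hT2]
    have hterm : ∀ k ∈ F.filter fun k => jj k = j,
        (wt (n + 1) k / T) ^ (-a) ≤ ((2 : ℝ) ^ j) ^ (-a) := fun k hk => by
      rw [Finset.mem_filter] at hk
      have := (hj k hk.1).1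
      rw [hk.2] at this
      exact Real.rpow_le_rpow_of_nonpos (by positivity) this (by linarith)
    have hρj : ((2 : ℝ) ^ j) ^ (-a) * 2 ^ j = ρ ^ j := by
      rw [hρ, ← Real.rpow_natCast, ← Real.rpow_natCast, ← Real.rpow_mul (by norm_num),
        ← Real.rpow_mul (by norm_num), ← Real.rpow_add (by norm_num)]
      congr 1; ring
    calc _ ≤ ∑ k ∈ F with jj k = j, ((2 : ℝ) ^ j) ^ (-a) := Finset.sum_le_sum hterm
      _ = ((F.filter fun k => jj k = j).card : ℝ) * ((2 : ℝ) ^ j) ^ (-a) := by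
          rw [Finset.sum_const, nsmul_eq_mul]
      _ ≤ 2 ^ (n + 1) * (T * 2 ^ (j + 1)) * ((1 + Real.log T) * (j + 2)) ^ n *
            ((2 : ℝ) ^ j) ^ (-a) := by
          refine mul_le_mul_of_nonneg_right (hcard.trans ?_) (by positivity)
          exact mul_le_mul_of_nonneg_left (pow_le_pow_left₀ hlog3 hlog2 n) (by positivity)
      _ = 2 ^ (n + 2) * (T * (1 + Real.log T) ^ n) * (((j : ℝ) + 2) ^ n *
            (((2 : ℝ) ^ j) ^ (-a) * 2 ^ j)) := by rw [mul_pow]; ring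
      _ = _ := by rw [hρj]
  calc _ ≤ ∑ j ∈ F.image jj,
        2 ^ (n + 2) * (T * (1 + Real.log T) ^ n) * (((j : ℝ) + 2) ^ n * ρ ^ j) :=
        Finset.sum_le_sum fun j _ => hfib j
    _ = 2 ^ (n + 2) * (T * (1 + Real.log T) ^ n) *
          ∑ j ∈ F.image jj, (((j : ℝ) + 2) ^ n * ρ ^ j) := by rw [Finset.mul_sum]
    _ ≤ 2 ^ (n + 2) * (T * (1 + Real.log T) ^ n) * ∑' j : ℕ, ((j : ℝ) + 2) ^ n * ρ ^ j :=
        mul_le_mul_of_nonneg_left (hsum.sum_le_tsum _ fun j _ => by positivity) (by positivity)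
    _ = _ := by ring

/-- Nonnegative sequences in the unit ball of the weighted `ℓ_θ` (quasi-)norm, `u = 1/θ`. -/
def IsWeightedBall (d : ℕ) (r u : ℝ) (b : (Fin d → ℤ) → ℝ) : Prop :=
  (∀ k, 0 ≤ b k) ∧ (u = 0 → ∀ k, wt d k ^ r * b k ≤ 1) ∧
    (0 < u → ∀ F : Finset (Fin d → ℤ), ∑ k ∈ F, (wt d k ^ r * b k) ^ (1 / u) ≤ 1)

theorem eq_rpow_neg_mul {w r b : ℝ} (hw : 0 < w) : b = w ^ (-r) * (w ^ r * b) := by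
  rw [← mul_assoc, ← Real.rpow_add hw]; simp

theorem sum_le_of_one_le {d : ℕ} {r u : ℝ} (hr : 0 < r) (hu : 1 ≤ u) {b : (Fin d → ℤ) → ℝ}
    (hb : IsWeightedBall d r u b) {s T : ℝ} (hs : 0 < s) (hT : 0 < T) (F : Finset (Fin d → ℤ))
    (hFT : ∀ k ∈ F, T < wt d k) (hFs : ∀ k ∈ F, wt d k ^ r * b k ≤ s ^ (-u)) :
    ∑ k ∈ F, b k ≤ T ^ (-r) * s ^ (1 - u) := by
  have hu0 : 0 < u := by linarith
  have hterm : ∀ k ∈ F, b k ≤ T ^ (-r) * s ^ (1 - u) * (wt d k ^ r * b k) ^ (1 / u) :=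
    fun k hk => by
      have hw := wt_pos d k
      set c := wt d k ^ r * b k with hc
      have hc0 : 0 ≤ c := mul_nonneg (by positivity) (hb.1 k)
      have h1 : c ≤ s ^ (1 - u) * c ^ (1 / u) := by
        rcases hc0.eq_or_lt with h | h
        · rw [← h]; positivity
        have h2 : c ^ (1 - 1 / u) ≤ (s ^ (-u)) ^ (1 - 1 / u) :=
          Real.rpow_le_rpow hc0 (hFs k hk) (by
            rw [sub_nonneg, div_le_one hu0]; exact hu)
        rw [← Real.rpow_mul hs.le] at h2
        have h3 : -u * (1 - 1 / u) = 1 - u := by field_simp; ring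
        rw [h3] at h2
        calc c = c ^ (1 - 1 / u) * c ^ (1 / u) := by
              rw [← Real.rpow_add h]; simp
          _ ≤ _ := mul_le_mul_of_nonneg_right h2 (by positivity)
      calc b k = wt d k ^ (-r) * c := eq_rpow_neg_mul hw
        _ ≤ T ^ (-r) * (s ^ (1 - u) * c ^ (1 / u)) :=
            mul_le_mul (Real.rpow_le_rpow_of_nonpos hT (hFT k hk).le (by linarith)) h1 hc0
              (by positivity)
        _ = _ := by ring
  calc _ ≤ _ := Finset.sum_le_sum hterm
    _ = T ^ (-r) * s ^ (1 - u) * ∑ k ∈ F, (wt d k ^ r * b k) ^ (1 / u) := by rw [Finset.mul_sum]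
    _ ≤ T ^ (-r) * s ^ (1 - u) * 1 := mul_le_mul_of_nonneg_left (hb.2.2 hu0 F) (by positivity)
    _ = _ := mul_one _

theorem exists_sum_le_of_lt_one (n : ℕ) {r u : ℝ} (hu0 : 0 ≤ u) (hu : u < 1) (hr : 1 - u < r) :
    ∃ A : ℝ, 0 ≤ A ∧ ∀ b, IsWeightedBall (n + 1) r u b → ∀ s T : ℝ, 0 < s → 1 ≤ T →
      ∀ F : Finset (Fin (n + 1) → ℤ), (∀ k ∈ F, T < wt (n + 1) k) →
        ∑ k ∈ F, b k ≤ T ^ (-r) * s ^ (1 - u) * (1 + s⁻¹ * (A * (T * (1 + Real.log T) ^ n))) := by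
  have hu1 : 0 < 1 - u := by linarith
  obtain ⟨A, hA0, hA⟩ := exists_sum_wt_rpow_le n (a := r / (1 - u)) (by rwa [one_lt_div hu1])
  refine ⟨A, hA0, fun b hb s T hs hT F hF => ?_⟩
  have hT0 : 0 < T := by linarith
  have hsum := hA T hT F hF
  have hpt : ∀ k ∈ F, b k ≤ T ^ (-r) * (wt (n + 1) k / T) ^ (-r) *
      (wt (n + 1) k ^ r * b k) := fun k hk => by
    have hw := wt_pos (n + 1) k
    rw [← Real.mul_rpow hT0.le (by positivity), mul_div_cancel₀ _ hT0.ne']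
    exact (eq_rpow_neg_mul hw).le
  rcases hu0.eq_or_lt with h | hupos
  · subst h
    have h1 : ∀ k ∈ F, b k ≤ T ^ (-r) * (wt (n + 1) k / T) ^ (-(r / (1 - 0))) := fun k hk => by
      refine (hpt k hk).trans ?_
      rw [sub_zero, div_one]
      exact mul_le_of_le_one_right (by have := wt_pos (n + 1) k; positivity) (hb.2.1 rfl k)
    calc _ ≤ _ := Finset.sum_le_sum h1
      _ = T ^ (-r) * ∑ k ∈ F, (wt (n + 1) k / T) ^ (-(r / (1 - 0))) := by rw [Finset.mul_sum]
      _ ≤ T ^ (-r) * (A * (T * (1 + Real.log T) ^ n)) :=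
          mul_le_mul_of_nonneg_left hsum (by positivity)
      _ ≤ T ^ (-r) * (s + A * (T * (1 + Real.log T) ^ n)) :=
          mul_le_mul_of_nonneg_left (by linarith) (by positivity)
      _ = _ := by rw [sub_zero, Real.rpow_one]; field_simp
  · have h1 : ∀ k ∈ F, b k ≤ T ^ (-r) * s ^ (1 - u) * ((wt (n + 1) k ^ r * b k) ^ (1 / u) +
        s⁻¹ * (wt (n + 1) k / T) ^ (-(r / (1 - u)))) := fun k hk => by
      refine (hpt k hk).trans ?_
      have hw := wt_pos (n + 1) k
      have hc0 : 0 ≤ wt (n + 1) k ^ r * b k := mul_nonneg (by positivity) (hb.1 k)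
      generalize wt (n + 1) k ^ r * b k = c at hc0
      have hy : 0 < wt (n + 1) k / T := by positivity
      generalize wt (n + 1) k / T = y at hy
      have key : y ^ (-r) * c ≤ s ^ (1 - u) * (c ^ (1 / u) + s⁻¹ * y ^ (-(r / (1 - u)))) := by
        rcases le_total c (s ^ (-u) * y ^ (-(r * u / (1 - u)))) with h | h
        · calc y ^ (-r) * c ≤ y ^ (-r) * (s ^ (-u) * y ^ (-(r * u / (1 - u)))) :=
                mul_le_mul_of_nonneg_left h (by positivity)
            _ = s ^ (-u) * y ^ (-(r / (1 - u))) := by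
                rw [mul_left_comm, ← Real.rpow_add hy]
                congr 2
                field_simp; ring
            _ = s ^ (1 - u) * (s⁻¹ * y ^ (-(r / (1 - u)))) := by
                rw [← mul_assoc, ← Real.rpow_neg_one s, ← Real.rpow_add hs]
                congr 2; ring
            _ ≤ _ := mul_le_mul_of_nonneg_left
                (le_add_of_nonneg_left (by positivity)) (by positivity)
        · have hτ : 0 < s ^ (-u) * y ^ (-(r * u / (1 - u))) := by positivity
          have hc : 0 < c := hτ.trans_le h
          have h2 : c ^ (1 - 1 / u) ≤ (s ^ (-u) * y ^ (-(r * u / (1 - u)))) ^ (1 - 1 / u) :=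
            Real.rpow_le_rpow_of_nonpos hτ h (by
              rw [sub_nonpos, one_le_div hupos]; exact hu.le)
          rw [Real.mul_rpow (by positivity) (by positivity), ← Real.rpow_mul hs.le,
            ← Real.rpow_mul hy.le] at h2
          have h3 : -u * (1 - 1 / u) = 1 - u := by field_simp; ring
          have h4 : -(r * u / (1 - u)) * (1 - 1 / u) = r := by field_simp; ring
          rw [h3, h4] at h2
          calc y ^ (-r) * c = y ^ (-r) * (c ^ (1 - 1 / u) * c ^ (1 / u)) := by
                rw [← Real.rpow_add hc]; simp
            _ ≤ y ^ (-r) * (s ^ (1 - u) * y ^ r * c ^ (1 / u)) :=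
                mul_le_mul_of_nonneg_left (mul_le_mul_of_nonneg_right h2 (by positivity))
                  (by positivity)
            _ = (y ^ (-r) * y ^ r) * (s ^ (1 - u) * c ^ (1 / u)) := by ring
            _ = s ^ (1 - u) * c ^ (1 / u) := by rw [← Real.rpow_add hy]; simp
            _ ≤ _ := mul_le_mul_of_nonneg_left
                (le_add_of_nonneg_right (by positivity)) (by positivity)
      rw [mul_assoc, mul_assoc]
      exact mul_le_mul_of_nonneg_left key (by positivity)
    calc _ ≤ _ := Finset.sum_le_sum h1
      _ = T ^ (-r) * s ^ (1 - u) * (∑ k ∈ F, (wt (n + 1) k ^ r * b k) ^ (1 / u) +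
            s⁻¹ * ∑ k ∈ F, (wt (n + 1) k / T) ^ (-(r / (1 - u)))) := by
          rw [← Finset.mul_sum, Finset.sum_add_distrib, Finset.mul_sum F _ s⁻¹]
      _ ≤ _ := mul_le_mul_of_nonneg_left (add_le_add (hb.2.2 hupos F)
          (mul_le_mul_of_nonneg_left hsum (by positivity))) (by positivity)

/-- Best sparse approximation in `ℓ_1` of sequences in the weighted ball. -/
theorem exists_sparse_approx (n : ℕ) {r u : ℝ} (hu0 : 0 ≤ u) (hr0 : 0 < r) (hr : 1 - u < r) :
    ∃ A : ℝ, 0 ≤ A ∧ ∀ b, IsWeightedBall (n + 1) r u b → ∀ s T : ℝ, 0 < s → 1 ≤ T →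
      ∀ F : Finset (Fin (n + 1) → ℤ), ∃ S ⊆ F,
        (S.card : ℝ) ≤ 2 ^ (n + 1) * T * (1 + Real.log T) ^ n + s ∧
        ∑ k ∈ F \ S, b k ≤
          T ^ (-r) * s ^ (1 - u) * (1 + s⁻¹ * (A * (T * (1 + Real.log T) ^ n))) := by
  classical
  obtain ⟨A, hA0, hA⟩ : ∃ A : ℝ, 0 ≤ A ∧ ∀ b, IsWeightedBall (n + 1) r u b →
      ∀ s T : ℝ, 0 < s → 1 ≤ T → ∀ F : Finset (Fin (n + 1) → ℤ), (∀ k ∈ F, T < wt (n + 1) k) →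
        (∀ k ∈ F, wt (n + 1) k ^ r * b k ≤ s ^ (-u)) →
        ∑ k ∈ F, b k ≤ T ^ (-r) * s ^ (1 - u) * (1 + s⁻¹ * (A * (T * (1 + Real.log T) ^ n))) := by
    rcases lt_or_ge u 1 with hu | hu
    · obtain ⟨A, hA0, hA⟩ := exists_sum_le_of_lt_one n hu0 hu hr
      exact ⟨A, hA0, fun b hb s T hs hT F hF _ => hA b hb s T hs hT F hF⟩
    · refine ⟨0, le_rfl, fun b hb s T hs hT F hF hFs => ?_⟩
      simpa using sum_le_of_one_le hr0 hu hb hs (by linarith) F hF hFs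
  refine ⟨A, hA0, fun b hb s T hs hT F => ?_⟩
  let S₁ := F.filter fun k => wt (n + 1) k ≤ T
  let S₂ := F.filter fun k => s ^ (-u) < wt (n + 1) k ^ r * b k
  refine ⟨S₁ ∪ S₂, Finset.union_subset (Finset.filter_subset _ _) (Finset.filter_subset _ _),
    ?_, ?_⟩
  · have h1 : (S₁.card : ℝ) ≤ 2 ^ (n + 1) * T * (1 + Real.log T) ^ n :=
      card_cross_le n hT S₁ fun k hk => (Finset.mem_filter.1 hk).2
    have h2 : (S₂.card : ℝ) ≤ s := by
      rcases hu0.eq_or_lt with h | hupos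
      · have : S₂ = ∅ := Finset.filter_eq_empty_iff.2 fun k _ => by
          rw [← h]; simpa using hb.2.1 h.symm k
        simp [this, hs.le]
      · have h3 : ∑ k ∈ S₂, s⁻¹ ≤ ∑ k ∈ S₂, (wt (n + 1) k ^ r * b k) ^ (1 / u) :=
          Finset.sum_le_sum fun k hk => by
            have h4 := Real.rpow_le_rpow (by positivity) (Finset.mem_filter.1 hk).2.le
              (show 0 ≤ 1 / u by positivity)
            rwa [← Real.rpow_mul hs.le, neg_mul, mul_one_div_cancel hupos.ne',
              Real.rpow_neg_one] at h4
        have h5 := h3.trans (hb.2.2 hupos S₂)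
        rwa [Finset.sum_const, nsmul_eq_mul, ← div_eq_mul_inv, div_le_one hs] at h5
    calc ((S₁ ∪ S₂).card : ℝ) ≤ S₁.card + S₂.card := by exact_mod_cast Finset.card_union_le _ _
      _ ≤ _ := add_le_add h1 h2
  · refine hA b hb s T hs hT _ (fun k hk => ?_) fun k hk => ?_
    all_goals
      rw [Finset.mem_sdiff, Finset.mem_union, not_or] at hk
      by_contra! hcon
    · exact hk.2.1 (Finset.mem_filter.2 ⟨hk.1, hcon⟩)
    · exact hk.2.2 (Finset.mem_filter.2 ⟨hk.1, hcon⟩)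

/-- Polynomial decay of the coefficients outside of hyperbolic crosses. -/
theorem exists_tail_le (n : ℕ) {r u : ℝ} (hu0 : 0 ≤ u) (hr : max (1 - u) 0 < r) :
    ∃ A β : ℝ, 0 ≤ A ∧ 0 < β ∧ ∀ b, IsWeightedBall (n + 1) r u b → ∀ T : ℝ, 1 ≤ T →
      ∀ F : Finset (Fin (n + 1) → ℤ), (∀ k ∈ F, T < wt (n + 1) k) →
        ∑ k ∈ F, b k ≤ A * T ^ (-β) := by
  have hr0 : 0 < r := (le_max_right _ _).trans_lt hr
  have hr1 : 1 - u < r := (le_max_left _ _).trans_lt hr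
  rcases lt_or_ge u 1 with hu | hu
  · obtain ⟨A, hA0, hA⟩ := exists_sum_le_of_lt_one n hu0 hu hr1
    set β := (r - (1 - u)) / 2 with hβ
    have hβ0 : 0 < β := by rw [hβ]; linarith
    obtain ⟨B, hB0, hB⟩ : ∃ B : ℝ, 0 ≤ B ∧ ∀ T : ℝ, 1 ≤ T → (1 + Real.log T) ^ n ≤ B * T ^ β := by
      refine ⟨(1 + (n + 1) / β) ^ n, by positivity, fun T hT => ?_⟩
      have hT0 : 0 < T := by linarith
      have hlog := Real.log_nonneg hT
      have h1 : 1 + Real.log T ≤ (1 + (n + 1) / β) * T ^ (β / (n + 1)) := by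
        have h2 := Real.log_le_rpow_div hT0.le (show 0 < β / (n + 1) by positivity)
        have h3 : 1 ≤ T ^ (β / (n + 1)) := Real.one_le_rpow hT (by positivity)
        rw [div_div_eq_mul_div, mul_div_assoc] at h2
        linarith
      calc (1 + Real.log T) ^ n ≤ ((1 + (n + 1) / β) * T ^ (β / (n + 1))) ^ n :=
            pow_le_pow_left₀ (by linarith) h1 n
        _ = (1 + (n + 1) / β) ^ n * T ^ (β / (n + 1) * n) := by
            rw [mul_pow, Real.rpow_mul hT0.le, Real.rpow_natCast]
        _ ≤ _ := by
            refine mul_le_mul_of_nonneg_left (Real.rpow_le_rpow_of_exponent_le hT ?_)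
              (by positivity)
            rw [div_mul_eq_mul_div, div_le_iff₀ (by positivity)]
            nlinarith
    refine ⟨1 + A * B, β, by positivity, hβ0, fun b hb T hT F hF => ?_⟩
    have hT0 : 0 < T := by linarith
    have h1 : 1 + T⁻¹ * (A * (T * (1 + Real.log T) ^ n)) ≤ (1 + A * B) * T ^ β := by
      have h2 : T⁻¹ * (A * (T * (1 + Real.log T) ^ n)) = A * (1 + Real.log T) ^ n := by
        field_simp
      have h3 : 1 ≤ T ^ β := Real.one_le_rpow hT hβ0.le
      have h4 := mul_le_mul_of_nonneg_left (hB T hT) hA0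
      rw [h2]; linarith
    calc _ ≤ _ := hA b hb T T hT0 hT F hF
      _ ≤ T ^ (-r) * T ^ (1 - u) * ((1 + A * B) * T ^ β) :=
          mul_le_mul_of_nonneg_left h1 (by positivity)
      _ = (1 + A * B) * (T ^ (-r) * T ^ (1 - u) * T ^ β) := by ring
      _ = _ := by
          rw [← Real.rpow_add hT0, ← Real.rpow_add hT0, hβ]
          congr 2; ring
  · refine ⟨1, r, zero_le_one, hr0, fun b hb T hT F hF => ?_⟩
    have hu' : 0 < u := by linarith
    have := sum_le_of_one_le hr0 hu hb one_pos (by linarith) F hF fun k hk => by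
      have hc0 : 0 ≤ wt (n + 1) k ^ r * b k :=
        mul_nonneg (Real.rpow_nonneg (wt_pos _ _).le _) (hb.1 k)
      have h1 := hb.2.2 hu' {k}
      rw [Finset.sum_singleton] at h1
      rw [Real.one_rpow]
      by_contra! h
      exact absurd h1 (not_le.2 (Real.one_lt_rpow h (by positivity)))
    simpa using this

theorem measurableSet_cube (d : ℕ) : MeasurableSet (cube d) :=
  MeasurableSet.univ_pi fun _ => measurableSet_Ico

theorem cube_ae_eq (d : ℕ) :
    cube d =ᵐ[volume] {x : Fin d → ℝ | ∀ i, x i ∈ Set.Ioc ((0 : Fin d → ℝ) i) ((0 : Fin d → ℝ) i + 1)} := by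
  have h := (Measure.univ_pi_Ico_ae_eq_Icc (μ := fun _ : Fin d => (volume : Measure ℝ))
    (f := 0) (g := 1)).trans
    (Measure.univ_pi_Ioc_ae_eq_Icc (μ := fun _ : Fin d => (volume : Measure ℝ))
    (f := 0) (g := 1)).symm
  have e : {x : Fin d → ℝ | ∀ i, x i ∈ Set.Ioc ((0 : Fin d → ℝ) i) ((0 : Fin d → ℝ) i + 1)} =
      Set.univ.pi fun i => Set.Ioc ((0 : Fin d → ℝ) i) ((1 : Fin d → ℝ) i) := by
    ext x; simp [Set.mem_pi]
  rw [e]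
  exact h

theorem volume_cube (d : ℕ) : volume (cube d) = 1 := by
  simp [cube, volume_pi_pi]

instance (d : ℕ) : IsProbabilityMeasure (volume.restrict (cube d)) :=
  ⟨by rw [Measure.restrict_apply_univ, volume_cube]⟩

theorem continuous_expk (d : ℕ) (k : Fin d → ℤ) : Continuous (expk d k) := by
  unfold expk; fun_prop

section Torus

local instance : MeasureSpace UnitAddCircle := ⟨AddCircle.haarAddCircle⟩

local instance : Measure.IsAddHaarMeasure (volume : Measure UnitAddCircle) :=
  inferInstanceAs (Measure.IsAddHaarMeasure AddCircle.haarAddCircle)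

local instance : IsProbabilityMeasure (volume : Measure UnitAddCircle) :=
  inferInstanceAs (IsProbabilityMeasure AddCircle.haarAddCircle)

theorem mFourier_coe (d : ℕ) (k : Fin d → ℤ) (x : Fin d → ℝ) :
    UnitAddTorus.mFourier k (fun i => (x i : UnitAddCircle)) = expk d k x := by
  rw [expk_eq_prod, UnitAddTorus.mFourier]
  simp only [ContinuousMap.coe_mk]
  refine Finset.prod_congr rfl fun i _ => ?_
  rw [fourier_coe_apply]
  congr 1
  push_cast; ring

/-- Parseval's identity on the cube. -/
theorem hasSum_sq_fCoeff (d : ℕ) {h : (Fin d → ℝ) → ℂ} (hc : Continuous h) :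
    HasSum (fun k => ‖fCoeff d h k‖ ^ 2) (∫ x in cube d, ‖h x‖ ^ 2) := by
  set e := UnitAddTorus.measurableEquivPiIoc (0 : Fin d → ℝ)
  let H : UnitAddTorus (Fin d) → ℂ := fun y => h (e y).1
  have hH : ∀ x : Fin d → ℝ, (∀ i, x i ∈ Set.Ioc ((0 : Fin d → ℝ) i) ((0 : Fin d → ℝ) i + 1)) →
      H (fun i => (x i : UnitAddCircle)) = h x := fun x hx => by
    have : (fun i => (x i : UnitAddCircle)) = e.symm ⟨x, hx⟩ := rfl
    rw [this]
    simp [H]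
  have hms : MeasurableSet {x : Fin d → ℝ | ∀ i, x i ∈ Set.Ioc ((0 : Fin d → ℝ) i) ((0 : Fin d → ℝ) i + 1)} :=
    MeasurableSet.univ_pi' fun i => measurableSet_Ioc
  obtain ⟨C, hC⟩ := (isCompact_Icc (a := (0 : Fin d → ℝ)) (b := 1)).exists_bound_of_continuousOn
    hc.continuousOn
  have hHm : Measurable H := hc.measurable.comp (measurable_subtype_coe.comp e.measurable)
  have hmem : MemLp H 2 volume := by
    refine MemLp.of_bound hHm.aestronglyMeasurable C (Filter.Eventually.of_forall fun y => ?_)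
    refine hC _ ⟨fun i => ((e y).2 i).1.le, fun i => ?_⟩
    simpa using ((e y).2 i).2
  have key := UnitAddTorus.hasSum_sq_mFourierCoeff hmem.toLp
  have h1 : ∀ k, UnitAddTorus.mFourierCoeff (hmem.toLp : UnitAddTorus (Fin d) → ℂ) k = fCoeff d h k := fun k => by
    trans UnitAddTorus.mFourierCoeff H k
    · exact integral_congr_ae (by
        filter_upwards [hmem.coeFn_toLp] with y hy
        rw [hy])
    rw [UnitAddTorus.mFourierCoeff_eq_integral _ _ (0 : Fin d → ℝ), fCoeff,
      setIntegral_congr_set (cube_ae_eq d)]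
    refine setIntegral_congr_fun hms fun x hx => ?_
    rw [hH x hx, mFourier_coe, smul_eq_mul, mul_comm]
  have h2 : ∫ t, ‖(hmem.toLp : UnitAddTorus (Fin d) → ℂ) t‖ ^ 2 = ∫ x in cube d, ‖h x‖ ^ 2 := by
    trans ∫ t, ‖H t‖ ^ 2
    · exact integral_congr_ae (by
        filter_upwards [hmem.coeFn_toLp] with y hy
        rw [hy])
    rw [UnitAddTorus.integral_preimage _ (0 : Fin d → ℝ), setIntegral_congr_set (cube_ae_eq d)]
    refine setIntegral_congr_fun hms fun x hx => ?_
    rw [hH x hx]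
  rw [h2] at key
  simpa only [h1] using key

end Torus

theorem integrableOn_cube (d : ℕ) {h : (Fin d → ℝ) → ℂ} (hc : Continuous h) :
    IntegrableOn h (cube d) :=
  (hc.continuousOn.integrableOn_compact (isCompact_Icc (a := (0 : Fin d → ℝ)) (b := 1))).mono_set
    fun _ hx => ⟨fun i => (hx i trivial).1, fun i => (hx i trivial).2.le⟩

theorem fCoeff_sub (d : ℕ) {f g : (Fin d → ℝ) → ℂ} (hf : Continuous f) (hg : Continuous g)
    (k : Fin d → ℤ) : fCoeff d (f - g) k = fCoeff d f k - fCoeff d g k := by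
  simpa only [fCoeff, Pi.sub_apply, Pi.mul_apply, sub_mul] using
    integral_sub (integrableOn_cube d (hf.mul (continuous_expk d (-k))))
      (integrableOn_cube d (hg.mul (continuous_expk d (-k))))

theorem expk_mul_expk_neg (d : ℕ) (k l : Fin d → ℤ) (x : Fin d → ℝ) :
    expk d k x * expk d (-l) x = expk d (k - l) x := by
  have h : expk d (-l) x = (starRingEnd ℂ) (expk d l x) := by
    have := expk_mul_conj d 0 l x
    rw [zero_sub] at this
    rw [← this]
    simp [expk]
  rw [h, expk_mul_conj]

theorem fCoeff_expk (d : ℕ) (k l : Fin d → ℤ) :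
    fCoeff d (expk d k) l = if l = k then 1 else 0 := by
  have h1 : fCoeff d (expk d k) k = 1 := by
    unfold fCoeff
    simp only [expk_mul_expk_neg, sub_self]
    simp [expk, measureReal_def]
  have h2 := hasSum_sq_fCoeff d (continuous_expk d k)
  simp only [norm_expk, one_pow, integral_const, smul_eq_mul, mul_one, probReal_univ] at h2
  split_ifs with h
  · rw [h, h1]
  · have h3 := sum_le_hasSum {l, k} (fun _ _ => by positivity) h2
    rw [Finset.sum_pair h, h1] at h3
    norm_num at h3
    exact h3

theorem cube_subset_closure_interior (d : ℕ) : cube d ⊆ closure (interior (cube d)) := by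
  unfold cube
  rw [interior_pi_set Set.finite_univ, closure_pi_set]
  intro x hx i hi
  rw [interior_Ico, closure_Ioo (by norm_num)]
  exact ⟨(hx i hi).1, (hx i hi).2.le⟩

/-- A continuous function with summable Fourier coefficients is the sum of its Fourier series. -/
theorem hasSum_fCoeff (d : ℕ) {h : (Fin d → ℝ) → ℂ} (hc : Continuous h)
    (hs : Summable fun k => ‖fCoeff d h k‖) {x : Fin d → ℝ} (hx : x ∈ cube d) :
    HasSum (fun k => fCoeff d h k * expk d k x) (h x) := by
  have hn : ∀ k x, ‖fCoeff d h k * expk d k x‖ = ‖fCoeff d h k‖ := fun k x => by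
    rw [norm_mul, norm_expk, mul_one]
  set g : (Fin d → ℝ) → ℂ := fun x => ∑' k, fCoeff d h k * expk d k x with hg
  have hgc : Continuous g := continuous_tsum (fun k => continuous_const.mul (continuous_expk d k))
    hs fun k x => (hn k x).le
  have hgk : ∀ l, fCoeff d g l = fCoeff d h l := fun l => by
    have h1 : ∀ k, ∫ x in cube d, fCoeff d h k * expk d k x * expk d (-l) x =
        if k = l then fCoeff d h l else 0 := fun k => by
      have := fCoeff_expk d k l
      simp only [mul_assoc]
      rw [integral_const_mul]
      unfold fCoeff at this
      rw [this]
      by_cases hkl : l = k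
      · simp [hkl]
      · rw [if_neg hkl, if_neg (Ne.symm hkl), mul_zero]
    have h2 := hasSum_integral_of_summable_integral_norm (μ := volume.restrict (cube d))
      (F := fun k x => fCoeff d h k * expk d k x * expk d (-l) x)
      (fun k => integrableOn_cube d ((continuous_const.mul (continuous_expk d k)).mul
        (continuous_expk d _))) (by simpa [norm_expk] using hs)
    simp only [h1] at h2
    have h3 := (hasSum_ite_eq l (fCoeff d h l)).unique h2
    rw [h3]
    unfold fCoeff
    refine integral_congr_ae (Filter.Eventually.of_forall fun x => ?_)
    simp only [hg]
    rw [← tsum_mul_right]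
    rfl
  have hP := hasSum_sq_fCoeff d (hc.sub hgc)
  simp only [fCoeff_sub d hc hgc, hgk, sub_self, norm_zero, ne_eq, OfNat.ofNat_ne_zero,
    not_false_eq_true, zero_pow] at hP
  have h0 := hP.unique hasSum_zero
  have hi : Integrable (fun x => ‖(h - g) x‖ ^ 2) (volume.restrict (cube d)) := by
    have := ((hc.sub hgc).norm.pow 2)
    exact (this.continuousOn.integrableOn_compact (isCompact_Icc (a := (0 : Fin d → ℝ)) (b := 1))).mono_set
      fun _ hx => ⟨fun i => (hx i trivial).1, fun i => (hx i trivial).2.le⟩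
  rw [integral_eq_zero_iff_of_nonneg (fun _ => by positivity) hi] at h0
  have h4 : h =ᵐ[volume.restrict (cube d)] g := by
    filter_upwards [h0] with x hx
    simpa [sub_eq_zero] using hx
  have h5 := Measure.eqOn_of_ae_eq h4 hc.continuousOn hgc.continuousOn
    (cube_subset_closure_interior d)
  rw [h5 hx]
  exact (Summable.of_norm (by simpa only [hn] using hs)).hasSum

theorem isWeightedBall_fCoeff (d : ℕ) (r : ℝ) {θ : ℝ≥0∞} (hθ : 0 < θ) {f : (Fin d → ℝ) → ℂ}
    (hf : wienerNorm d r θ f ≤ 1) :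
    IsWeightedBall d r (1 / θ.toReal) fun k => ‖fCoeff d f k‖ := by
  have hw : ∀ k, 0 ≤ wt d k ^ r := fun k => (rpow_pos_of_pos (wt_pos d k) r).le
  have hof : ∀ k, ENNReal.ofReal (wt d k ^ r) * (‖fCoeff d f k‖₊ : ℝ≥0∞) =
      ENNReal.ofReal (wt d k ^ r * ‖fCoeff d f k‖) := fun k => by
    rw [ENNReal.ofReal_mul (hw k), ofReal_norm]
    rfl
  unfold wienerNorm at hf
  simp only [hof] at hf
  refine ⟨fun k => norm_nonneg _, fun hu k => ?_, fun hu F => ?_⟩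
  · have hinf : θ = ∞ := by
      by_contra h
      have := ENNReal.toReal_pos hθ.ne' h
      have : 0 < 1 / θ.toReal := by positivity
      exact this.ne' hu
    rw [if_pos hinf] at hf
    simpa using (le_iSup (fun k => ENNReal.ofReal (wt d k ^ r * ‖fCoeff d f k‖)) k).trans hf
  · have hinf : θ ≠ ∞ := by
      rintro rfl
      simp at hu
    have hp := ENNReal.toReal_pos hθ.ne' hinf
    rw [if_neg hinf, one_div, ENNReal.rpow_inv_le_iff hp, ENNReal.one_rpow] at hf
    have h1 := (ENNReal.sum_le_tsum F).trans hf
    simp only [ENNReal.ofReal_rpow_of_nonneg (mul_nonneg (hw _) (norm_nonneg _)) hp.le] at h1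
    rw [← ENNReal.ofReal_sum_of_nonneg
      (fun k _ => rpow_nonneg (mul_nonneg (hw _) (norm_nonneg _)) _)] at h1
    rw [one_div_one_div]
    simpa using h1

theorem eq_zero_of_wt_le_one (d : ℕ) {k : Fin d → ℤ} (h : wt d k ≤ 1) : k = 0 := by
  funext i
  have h1 := (one_add_abs_le_wt d k i).trans h
  have h2 : |(k i : ℝ)| ≤ 0 := by linarith
  simpa using h2

theorem IsWeightedBall.summable {n : ℕ} {r u : ℝ} (hu0 : 0 ≤ u) (hr : max (1 - u) 0 < r)
    {b : (Fin (n + 1) → ℤ) → ℝ} (hb : IsWeightedBall (n + 1) r u b) : Summable b := by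
  obtain ⟨A, β, _, _, h⟩ := exists_tail_le n hu0 hr
  refine summable_of_sum_le (c := b 0 + A * 1 ^ (-β)) hb.1 fun F => ?_
  rw [← Finset.sum_filter_add_sum_filter_not F fun k => wt (n + 1) k ≤ 1]
  refine add_le_add ?_ (h b hb 1 le_rfl _ fun k hk => not_le.1 (Finset.mem_filter.1 hk).2)
  calc _ ≤ ∑ k ∈ {0}, b k := Finset.sum_le_sum_of_subset_of_nonneg (fun k hk => by
        simpa using eq_zero_of_wt_le_one _ (Finset.mem_filter.1 hk).2) fun k _ _ => hb.1 k
    _ = b 0 := by simp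

theorem norm_sum_box_le {d : ℕ} {c : (Fin d → ℤ) → ℂ} (Q : Finset (Fin d → ℤ))
    {τ : ℝ}
    (hτ : ∀ F : Finset (Fin d → ℤ), Disjoint F Q → ∑ k ∈ F, ‖c k‖ ≤ τ) {x : Fin d → ℝ}
    (hx : HasSum (fun k => c k * expk d k x) 0) : ‖∑ k ∈ Q, c k * expk d k x‖ ≤ τ := by
  have h1 := (Filter.Tendsto.sub_const hx (∑ k ∈ Q, c k * expk d k x)).norm
  rw [zero_sub, norm_neg] at h1
  refine le_of_tendsto h1 ((Filter.eventually_ge_atTop Q).mono fun F hF => ?_)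
  rw [← Finset.sum_sdiff hF, add_sub_cancel_right]
  refine (norm_sum_le_of_le _ fun k _ => ?_).trans (hτ (F \ Q) Finset.sdiff_disjoint)
  rw [norm_mul, norm_expk, mul_one]

theorem coeff_bounds {ι : Type*} [DecidableEq ι] {Q S : Finset ι} {c : ι → ℂ}
    {B η s D X : ℝ} (hS : (S.card : ℝ) ≤ 4 * s) (hSQ : S ⊆ Q)
    (hB : ∑ k ∈ Q \ S, ‖c k‖ ≤ 2 * B)
    (htail : ∀ F : Finset ι, Disjoint F Q → ∑ k ∈ F, ‖c k‖ ≤ 2 * η) (hs1 : 1 ≤ s)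
    (hD : 16 * s * D ≤ 1) (hX : 1 ≤ X) (hη : X * (2 * η) ^ 2 ≤ B ^ 2 / s)
    (hdich : ∑ k ∈ Q, ‖c k‖ ^ 2 ≤ D * (∑ k ∈ Q, ‖c k‖) ^ 2 ∨
      (∑ k ∈ Q, ‖c k‖) ^ 2 ≤ X * (2 * η) ^ 2) :
    ∑' k, ‖c k‖ ≤ 5 * B ∧ ∑' k, ‖c k‖ ^ 2 ≤ (5 * B) ^ 2 / s := by
  have hη0 : 0 ≤ η := by simpa using htail ∅ (by simp)
  have hB0 : 0 ≤ B := by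
    have : 0 ≤ ∑ k ∈ Q \ S, ‖c k‖ := Finset.sum_nonneg fun _ _ => norm_nonneg _
    linarith
  have hBs : B ^ 2 / s ≤ B ^ 2 := div_le_self (sq_nonneg _) hs1
  have hη2 : (2 * η) ^ 2 ≤ B ^ 2 / s := (le_mul_of_one_le_left (sq_nonneg _) hX).trans hη
  have hηB : 2 * η ≤ B := abs_le_of_sq_le_sq' (hη2.trans hBs) hB0 |>.2
  set W := ∑ k ∈ Q, ‖c k‖ with hW
  have hW0 : 0 ≤ W := Finset.sum_nonneg fun _ _ => norm_nonneg _
  have hsq : ∀ F : Finset ι, ∑ k ∈ F, ‖c k‖ ^ 2 ≤ (∑ k ∈ F, ‖c k‖) ^ 2 := fun F =>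
    Finset.sum_sq_le_sq_sum_of_nonneg fun _ _ => norm_nonneg _
  have hmain : W ≤ 4 * B ∧ ∑ k ∈ Q, ‖c k‖ ^ 2 ≤ B ^ 2 / s := by
    rcases hdich with h | h
    · have h1 : (∑ k ∈ S, ‖c k‖) ^ 2 ≤ (W / 2) ^ 2 := by
        calc _ ≤ (S.card : ℝ) * ∑ k ∈ S, ‖c k‖ ^ 2 := sq_sum_le_card_mul_sum_sq
          _ ≤ 4 * s * (D * W ^ 2) := by
            refine mul_le_mul hS ((Finset.sum_le_sum_of_subset_of_nonneg hSQ
              fun _ _ _ => sq_nonneg _).trans h) (Finset.sum_nonneg fun _ _ => sq_nonneg _) (by linarith)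
          _ = (16 * s * D) * (W / 2) ^ 2 := by ring
          _ ≤ (W / 2) ^ 2 := mul_le_of_le_one_left (sq_nonneg _) hD
      have h2 := (abs_le_of_sq_le_sq' h1 (by linarith)).2
      have h3 : W = ∑ k ∈ Q \ S, ‖c k‖ + ∑ k ∈ S, ‖c k‖ := (Finset.sum_sdiff hSQ).symm
      have h4 : W ≤ 4 * B := by linarith
      refine ⟨h4, h.trans ?_⟩
      rw [le_div_iff₀ (by linarith)]
      have h5 : W ^ 2 ≤ (4 * B) ^ 2 := pow_le_pow_left₀ hW0 h4 2
      have h6 : D * W ^ 2 * s = (16 * s * D) * (W ^ 2 / 16) := by ring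
      rw [h6]
      calc _ ≤ W ^ 2 / 16 := mul_le_of_le_one_left (by positivity) hD
        _ ≤ B ^ 2 := by linarith
    · have h1 := h.trans hη
      exact ⟨by have := (abs_le_of_sq_le_sq' (h1.trans hBs) hB0).2; linarith, (hsq Q).trans h1⟩
  have hsplit : ∀ (g : ι → ℝ), (∀ k, 0 ≤ g k) → ∀ F : Finset ι,
      ∑ k ∈ F, g k ≤ ∑ k ∈ Q, g k + ∑ k ∈ F \ Q, g k := fun g hg F => by
    rw [add_comm, ← Finset.sum_union Finset.sdiff_disjoint]
    exact Finset.sum_le_sum_of_subset_of_nonneg (fun k hk => by simp; tauto) fun k _ _ => hg k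
  constructor
  · refine Real.tsum_le_of_sum_le (fun _ => norm_nonneg _) fun F => ?_
    have := hsplit (fun k => ‖c k‖) (fun _ => norm_nonneg _) F
    have := htail (F \ Q) Finset.sdiff_disjoint
    linarith [hmain.1]
  · refine Real.tsum_le_of_sum_le (fun _ => sq_nonneg _) fun F => ?_
    have h1 := hsplit (fun k => ‖c k‖ ^ 2) (fun _ => sq_nonneg _) F
    have h2 := htail (F \ Q) Finset.sdiff_disjoint
    have h3 := (hsq (F \ Q)).trans (pow_le_pow_left₀ (Finset.sum_nonneg fun _ _ => norm_nonneg _) h2 2)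
    have h4 : (5 * B) ^ 2 / s = 25 * (B ^ 2 / s) := by ring
    have h5 : 0 ≤ B ^ 2 / s := by positivity
    linarith [hmain.2]

theorem LqNorm_le (d : ℕ) {q : ℝ≥0∞} (hq : 2 ≤ q) {h : (Fin d → ℝ) → ℂ} (hc : Continuous h)
    {A s : ℝ} (hA0 : 0 ≤ A) (hs : 0 < s) (hA : ∀ x ∈ cube d, ‖h x‖ ≤ A)
    (h2 : ∫ x in cube d, ‖h x‖ ^ 2 ≤ A ^ 2 / s) :
    LqNorm d q h ≤ ENNReal.ofReal (A * s ^ (-(1 / q.toReal))) := by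
  have hae : ∀ᵐ x ∂(volume.restrict (cube d)), ‖h x‖ ≤ A :=
    (ae_restrict_iff' (measurableSet_cube d)).2 (Filter.Eventually.of_forall hA)
  unfold LqNorm
  by_cases hinf : q = ∞
  · subst hinf
    simp only [ENNReal.toReal_top, _root_.div_zero, neg_zero, Real.rpow_zero, mul_one, eLpNorm_exponent_top]
    exact eLpNormEssSup_le_of_ae_bound hae
  have hq0 : q ≠ 0 := (lt_of_lt_of_le (by norm_num) hq).ne'
  have hp2 : 2 ≤ q.toReal := by
    simpa using (ENNReal.toReal_le_toReal (by norm_num) hinf).2 hq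
  set p := q.toReal with hp
  have hp0 : 0 < p := by linarith
  rw [eLpNorm_eq_lintegral_rpow_enorm_toReal hq0 hinf, ← hp]
  have hbound : ∫⁻ x in cube d, ‖h x‖ₑ ^ p ≤ ENNReal.ofReal (A ^ p / s) := by
    calc ∫⁻ x in cube d, ‖h x‖ₑ ^ p ≤ ∫⁻ x in cube d, ENNReal.ofReal (A ^ (p - 2) * ‖h x‖ ^ 2) := by
          refine lintegral_mono_ae ?_
          filter_upwards [hae] with x hx
          rw [← ofReal_norm, ENNReal.ofReal_rpow_of_nonneg (norm_nonneg _) hp0.le]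
          refine ENNReal.ofReal_le_ofReal ?_
          rcases (norm_nonneg (h x)).eq_or_lt with h0 | h0
          · rw [← h0, zero_rpow hp0.ne']; simp
          · have : ‖h x‖ ^ p = ‖h x‖ ^ (p - 2) * ‖h x‖ ^ 2 := by
              rw [← Real.rpow_natCast, ← rpow_add h0]; norm_num
            rw [this]
            exact mul_le_mul_of_nonneg_right (rpow_le_rpow h0.le hx (by linarith)) (sq_nonneg _)
      _ = ENNReal.ofReal (∫ x in cube d, A ^ (p - 2) * ‖h x‖ ^ 2) := by
          rw [ofReal_integral_eq_lintegral_ofReal]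
          · refine Integrable.const_mul ?_ _
            exact ((hc.norm.pow 2).continuousOn.integrableOn_compact
              (isCompact_Icc (a := (0 : Fin d → ℝ)) (b := 1))).mono_set
              fun _ hx => ⟨fun i => (hx i trivial).1, fun i => (hx i trivial).2.le⟩
          · exact Filter.Eventually.of_forall fun x => by positivity
      _ ≤ _ := by
          refine ENNReal.ofReal_le_ofReal ?_
          rw [integral_const_mul]
          refine (mul_le_mul_of_nonneg_left h2 (rpow_nonneg hA0 _)).trans (le_of_eq ?_)
          rcases hA0.eq_or_lt with h0 | h0
          · rw [← h0, zero_rpow hp0.ne']; simp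
          · rw [← mul_div_assoc, ← Real.rpow_natCast A 2, ← rpow_add h0]; norm_num
  refine (ENNReal.rpow_le_rpow hbound (by positivity)).trans ?_
  rw [ENNReal.ofReal_rpow_of_nonneg (by positivity) (by positivity)]
  refine ENNReal.ofReal_le_ofReal (le_of_eq ?_)
  rw [div_rpow (by positivity) hs.le, ← rpow_mul hA0, mul_one_div_cancel hp0.ne', Real.rpow_one,
    rpow_neg hs.le, div_eq_mul_inv]

theorem lt_wt_of_notMem_box {d M : ℕ} {k : Fin d → ℤ} (hk : k ∉ box d M) : (M : ℝ) < wt d k := by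
  simp only [box, Fintype.mem_piFinset, Finset.mem_Icc, not_forall, ← abs_le, not_le] at hk
  obtain ⟨i, hi⟩ := hk
  have h1 : (M : ℝ) < |(k i : ℝ)| := by exact_mod_cast hi
  linarith [one_add_abs_le_wt d k i]

theorem samplingWidth_le_of_forall_sub {d m : ℕ} {N : ((Fin d → ℝ) → ℂ) → ℝ≥0∞} {q ε : ℝ≥0∞}
    (t : Fin m → Fin d → ℝ) (ht : ∀ i, t i ∈ cube d)
    (h : ∀ f g : (Fin d → ℝ) → ℂ, Continuous f → N f ≤ 1 → Continuous g → N g ≤ 1 →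
      (∀ i, f (t i) = g (t i)) → LqNorm d q (f - g) ≤ ε) :
    samplingWidth d m N q ≤ ε := by
  classical
  let R : (Fin m → ℂ) → (Fin d → ℝ) → ℂ := fun y =>
    if hy : ∃ g : (Fin d → ℝ) → ℂ, Continuous g ∧ N g ≤ 1 ∧ ∀ i, y i = g (t i) then hy.choose else 0
  refine iInf_le_of_le t (iInf_le_of_le ht (iInf_le_of_le R (iSup₂_le fun f hf => ?_)))
  have hy : ∃ g : (Fin d → ℝ) → ℂ, Continuous g ∧ N g ≤ 1 ∧ ∀ i, f (t i) = g (t i) :=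
    ⟨f, hf.1, hf.2, fun _ => rfl⟩
  have hR : R (fun i => f (t i)) = hy.choose := dif_pos hy
  rw [hR]
  exact h f _ hf.1 hf.2 hy.choose_spec.1 hy.choose_spec.2.1 hy.choose_spec.2.2

theorem samplingWidth_le_of_params (n m : ℕ) {θ q : ℝ≥0∞} (hθ : 0 < θ) (hq : 2 ≤ q) {r : ℝ}
    (hr : max (1 - 1 / θ.toReal) 0 < r) {M J P : ℕ} {s D B η : ℝ} (hJ : 1 ≤ J) (hJP : J ≤ P)
    (hP : 5 * (2 * M + 1 : ℝ) ^ (n + 1) ≤ exp P) (hD : 20000 * J * (P : ℝ) ^ 2 ≤ m * D)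
    (hJD : (1 / 2 : ℝ) ^ J ≤ D / 8) (hs : 1 ≤ s) (hsD : 16 * s * D ≤ 1)
    (hsparse : ∀ b, IsWeightedBall (n + 1) r (1 / θ.toReal) b → ∀ F : Finset (Fin (n + 1) → ℤ),
      ∃ S ⊆ F, (S.card : ℝ) ≤ 2 * s ∧ ∑ k ∈ F \ S, b k ≤ B)
    (htail : ∀ b, IsWeightedBall (n + 1) r (1 / θ.toReal) b → ∀ F : Finset (Fin (n + 1) → ℤ),
      (∀ k ∈ F, (M : ℝ) < wt (n + 1) k) → ∑ k ∈ F, b k ≤ η)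
    (hη : (2 : ℝ) ^ J * (2 * η) ^ 2 ≤ B ^ 2 / s) :
    samplingWidth (n + 1) m (wienerNorm (n + 1) r θ) q ≤
      ENNReal.ofReal (5 * B * s ^ (-(1 / q.toReal))) := by
  classical
  obtain ⟨t, ht, hdich⟩ := exists_sampling_points (n + 1) M hJ hJP hP hD hJD
  refine samplingWidth_le_of_forall_sub t ht fun f g hf hNf hg hNg hfg => ?_
  have hbf := isWeightedBall_fCoeff (n + 1) r hθ hNf
  have hbg := isWeightedBall_fCoeff (n + 1) r hθ hNg
  have hu : 0 ≤ 1 / θ.toReal := by positivity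
  set c := fCoeff (n + 1) (f - g) with hc
  have hcle : ∀ k, ‖c k‖ ≤ ‖fCoeff (n + 1) f k‖ + ‖fCoeff (n + 1) g k‖ := fun k => by
    rw [hc, fCoeff_sub _ hf hg]
    exact norm_sub_le _ _
  have hsum : Summable fun k => ‖c k‖ := Summable.of_nonneg_of_le (fun _ => norm_nonneg _) hcle
    ((hbf.summable hu hr).add (hbg.summable hu hr))
  have hser := fun x (hx : x ∈ cube (n + 1)) => hasSum_fCoeff (n + 1) (hf.sub hg) hsum hx
  have htl : ∀ F : Finset (Fin (n + 1) → ℤ), Disjoint F (box (n + 1) M) →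
      ∑ k ∈ F, ‖c k‖ ≤ 2 * η := fun F hF => by
    have hM : ∀ k ∈ F, (M : ℝ) < wt (n + 1) k := fun k hk =>
      lt_wt_of_notMem_box (Finset.disjoint_left.1 hF hk)
    have h1 := Finset.sum_le_sum fun k (_ : k ∈ F) => hcle k
    rw [Finset.sum_add_distrib] at h1
    linarith [htail _ hbf F hM, htail _ hbg F hM]
  obtain ⟨Sf, hSf, hSfc, hSfB⟩ := hsparse _ hbf (box (n + 1) M)
  obtain ⟨Sg, hSg, hSgc, hSgB⟩ := hsparse _ hbg (box (n + 1) M)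
  have hB : ∑ k ∈ box (n + 1) M \ (Sf ∪ Sg), ‖c k‖ ≤ 2 * B := by
    have h1 := Finset.sum_le_sum fun k (_ : k ∈ box (n + 1) M \ (Sf ∪ Sg)) => hcle k
    rw [Finset.sum_add_distrib] at h1
    have h2 := (Finset.sum_le_sum_of_subset_of_nonneg (Finset.sdiff_subset_sdiff le_rfl
      (Finset.subset_union_left (s₁ := Sf) (s₂ := Sg))) fun k _ _ => hbf.1 k).trans hSfB
    have h3 := (Finset.sum_le_sum_of_subset_of_nonneg (Finset.sdiff_subset_sdiff le_rfl
      (Finset.subset_union_right (s₁ := Sf) (s₂ := Sg))) fun k _ _ => hbg.1 k).trans hSgB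
    linarith
  have hcard : ((Sf ∪ Sg).card : ℝ) ≤ 4 * s := by
    have : ((Sf ∪ Sg).card : ℝ) ≤ Sf.card + Sg.card := by exact_mod_cast Finset.card_union_le Sf Sg
    linarith
  have hsmall : ∀ l, ‖∑ k ∈ box (n + 1) M, c k * expk (n + 1) k (t l)‖ ≤ 2 * η := fun l => by
    refine norm_sum_box_le _ htl ?_
    have := hser (t l) (ht l)
    rwa [Pi.sub_apply, hfg l, sub_self] at this
  obtain ⟨h1, h2⟩ := coeff_bounds hcard (Finset.union_subset hSf hSg) hB htl hs hsD
    (one_le_pow₀ (by norm_num)) hη (hdich c (2 * η) hsmall)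
  have hB0 : 0 ≤ 5 * B := (tsum_nonneg fun k => norm_nonneg (c k)).trans h1
  refine LqNorm_le (n + 1) hq (hf.sub hg) hB0 (by linarith) (fun x hx => ?_) ?_
  · have hn : ∀ k, ‖fCoeff (n + 1) (f - g) k * expk (n + 1) k x‖ = ‖c k‖ := fun k => by
      rw [norm_mul, norm_expk, mul_one]
    rw [← (hser x hx).tsum_eq]
    refine (norm_tsum_le_tsum_norm (by simpa only [hn] using hsum)).trans ?_
    simpa only [hn] using h1
  · rw [← (hasSum_sq_fCoeff (n + 1) (hf.sub hg)).tsum_eq]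
    exact h2

theorem one_le_logStar (m : ℕ) : 1 ≤ logStar m := le_max_right _ _

theorem log_le_logStar {m : ℕ} (hm : 1 ≤ m) : Real.log m ≤ logStar m := by
  refine le_trans ?_ (le_max_left _ _)
  have h0 : 0 ≤ Real.log m := Real.log_nonneg (by exact_mod_cast hm)
  have h1 : Real.log 2 ≤ 1 := by linarith [Real.log_two_lt_d9]
  exact le_div_self h0 (Real.log_pos (by norm_num)) h1

theorem natLog_add_one_le (m : ℕ) (hm : 1 ≤ m) : ((Nat.log 2 m + 1 : ℕ) : ℝ) ≤ 2 * logStar m := by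
  have h1 : (Nat.log 2 m : ℝ) ≤ logStar m := by
    refine le_trans ?_ (le_max_left _ _)
    rw [Real.le_logb_iff_rpow_le (by norm_num) (by exact_mod_cast hm), Real.rpow_natCast]
    exact_mod_cast Nat.pow_log_le_self 2 (by omega)
  push_cast
  linarith [one_le_logStar m]

theorem eventually_mul_logStar_pow_le (K : ℝ) (n : ℕ) :
    ∃ m₀ : ℕ, ∀ m : ℕ, m₀ ≤ m → K * logStar m ^ n ≤ m := by
  have h1 : (fun m : ℕ => K * (Real.log m / Real.log 2) ^ n) =o[Filter.atTop] fun m : ℕ => (m : ℝ) := by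
    have h0 : (fun m : ℕ => Real.log (m : ℝ) ^ n) =o[Filter.atTop] fun m : ℕ => (m : ℝ) :=
      (isLittleO_pow_log_id_atTop (n := n)).comp_tendsto tendsto_natCast_atTop_atTop
    refine (h0.const_mul_left (K * (Real.log 2 ^ n)⁻¹)).congr_left fun m => ?_
    rw [div_pow]; ring
  have h2 := h1.bound (c := 1) one_pos
  obtain ⟨m₀, h⟩ := Filter.eventually_atTop.1 h2
  refine ⟨max m₀ 2, fun m hm => ?_⟩
  have h3 := h m ((le_max_left _ _).trans hm)
  have h4 : logStar m = Real.log m / Real.log 2 := by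
    refine max_eq_left ?_
    rw [Real.le_logb_iff_rpow_le (by norm_num) (by
      have := (le_max_right m₀ 2).trans hm
      exact_mod_cast (by omega : 0 < m)), Real.rpow_one]
    exact_mod_cast (le_max_right m₀ 2).trans hm
  rw [h4]
  refine (le_abs_self _).trans ?_
  simpa only [Real.norm_eq_abs, Nat.abs_cast, one_mul] using h3

theorem five_mul_pow_le_exp {m κ n J : ℕ} (hm : 2 ≤ m) (hJ : m ≤ 2 ^ J) :
    5 * (2 * (m ^ κ : ℕ) + 1 : ℝ) ^ (n + 1) ≤ exp (((κ + 2) * (n + 1) + 3) * J : ℕ) := by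
  have h1 : 5 * (2 * m ^ κ + 1) ^ (n + 1) ≤ m ^ ((κ + 2) * (n + 1) + 3) := by
    have ha : 5 ≤ m ^ 3 := (by norm_num : 5 ≤ 2 ^ 3).trans (Nat.pow_le_pow_left hm 3)
    have hb : 2 * m ^ κ + 1 ≤ m ^ (κ + 2) := by
      have h4 : 4 ≤ m ^ 2 := (by norm_num : 4 ≤ 2 ^ 2).trans (Nat.pow_le_pow_left hm 2)
      have h5 : 1 ≤ m ^ κ := Nat.one_le_pow _ _ (by omega)
      rw [pow_add]
      nlinarith
    rw [pow_add m, mul_comm, pow_mul]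
    exact Nat.mul_le_mul (Nat.pow_le_pow_left hb _) ha
  calc 5 * (2 * (m ^ κ : ℕ) + 1 : ℝ) ^ (n + 1) ≤ (m : ℝ) ^ ((κ + 2) * (n + 1) + 3) := by
        exact_mod_cast h1
    _ ≤ (exp J) ^ ((κ + 2) * (n + 1) + 3) := by
        refine pow_le_pow_left₀ (by positivity) ?_ _
        calc (m : ℝ) ≤ 2 ^ J := by exact_mod_cast hJ
          _ ≤ (exp 1) ^ J := pow_le_pow_left₀ (by norm_num) (by linarith [Real.exp_one_gt_d9]) _
          _ = exp J := by rw [← Real.exp_nat_mul, mul_one]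
    _ = _ := by
        rw [← Real.exp_nat_mul]
        push_cast; rfl

/-- Sparse approximation on boxes at the sparsity level dictated by the number of samples. -/
theorem exists_sparse_approx_logStar (n : ℕ) {r u : ℝ} (hu0 : 0 ≤ u) (hr0 : 0 < r)
    (hr : 1 - u < r) :
    ∃ C : ℝ, 1 ≤ C ∧ ∀ (m : ℕ) (s : ℝ), 1 ≤ m → s ≤ m → 2 ^ (n + 1) * (2 * logStar m) ^ n ≤ s →
      ∀ b, IsWeightedBall (n + 1) r u b → ∀ F : Finset (Fin (n + 1) → ℤ),
      ∃ S ⊆ F, (S.card : ℝ) ≤ 2 * s ∧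
        ∑ k ∈ F \ S, b k ≤ C * (s ^ (1 - u - r) * logStar m ^ (n * r)) := by
  obtain ⟨A, hA, h⟩ := exists_sparse_approx n hu0 hr0 hr
  refine ⟨(2 ^ (n + 1) * 2 ^ n) ^ r * (1 + A), ?_, fun m s hm hsm hs b hb F => ?_⟩
  · refine one_le_mul_of_one_le_of_one_le (Real.one_le_rpow ?_ hr0.le) (by linarith)
    exact one_le_mul_of_one_le_of_one_le (one_le_pow₀ (by norm_num)) (one_le_pow₀ (by norm_num))
  set l := logStar m with hl
  have hl1 : 1 ≤ l := one_le_logStar m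
  have hl0 : 0 < l := by linarith
  set Z : ℝ := 2 ^ (n + 1) * (2 * l) ^ n with hZ
  have hZ1 : 1 ≤ Z := one_le_mul_of_one_le_of_one_le (one_le_pow₀ (by norm_num))
    (one_le_pow₀ (by linarith))
  have hZ0 : 0 < Z := by linarith
  have hs0 : 0 < s := by linarith
  have hT : 1 ≤ s / Z := (one_le_div hZ0).2 hs
  have hlog : 1 + Real.log (s / Z) ≤ 2 * l := by
    have h1 : Real.log (s / Z) ≤ Real.log m :=
      Real.log_le_log (by linarith) ((div_le_self hs0.le hZ1).trans hsm)
    linarith [log_le_logStar hm]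
  have hlog0 : 0 ≤ 1 + Real.log (s / Z) := by linarith [Real.log_nonneg hT]
  have hTl : s / Z * (1 + Real.log (s / Z)) ^ n ≤ s / 2 ^ (n + 1) := by
    calc _ ≤ s / Z * (2 * l) ^ n :=
          mul_le_mul_of_nonneg_left (pow_le_pow_left₀ hlog0 hlog n) (by positivity)
      _ = _ := by rw [hZ]; field_simp
  obtain ⟨S, hSF, hS, hsum⟩ := h b hb s (s / Z) hs0 hT F
  refine ⟨S, hSF, hS.trans ?_, hsum.trans ?_⟩
  · have h1 : 2 ^ (n + 1) * (s / Z) * (1 + Real.log (s / Z)) ^ n ≤ s := by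
      rw [mul_assoc]
      calc _ ≤ 2 ^ (n + 1) * (s / 2 ^ (n + 1)) := mul_le_mul_of_nonneg_left hTl (by positivity)
        _ = s := by field_simp
    linarith
  · have h1 : s⁻¹ * (A * (s / Z * (1 + Real.log (s / Z)) ^ n)) ≤ A := by
      have h2 : s / Z * (1 + Real.log (s / Z)) ^ n ≤ s :=
        hTl.trans (div_le_self hs0.le (one_le_pow₀ (by norm_num)))
      calc _ ≤ s⁻¹ * (A * s) := by gcongr
        _ = A := by field_simp
    have h3 : (s / Z) ^ (-r) = s ^ (-r) * ((2 ^ (n + 1) * 2 ^ n) ^ r * l ^ (n * r)) := by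
      rw [div_rpow hs0.le hZ0.le, Real.rpow_neg hZ0.le, div_inv_eq_mul, hZ, mul_pow, ← mul_assoc,
        mul_rpow (by positivity) (by positivity), Real.rpow_mul hl0.le, Real.rpow_natCast]
    calc _ ≤ (s / Z) ^ (-r) * s ^ (1 - u) * (1 + A) := by gcongr
      _ = (2 ^ (n + 1) * 2 ^ n) ^ r * (1 + A) * ((s ^ (1 - u) * s ^ (-r)) * l ^ (n * r)) := by
        rw [h3]; ring
      _ = _ := by rw [← Real.rpow_add hs0, ← sub_eq_add_neg]

theorem tail_sq_le {m J κ : ℕ} {A C β r u s l : ℝ} {n : ℕ} (hm : 1 ≤ m) (hA0 : 0 ≤ A) (hA : 8 * A ^ 2 ≤ m)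
    (hJ : (2 : ℝ) ^ J ≤ 2 * m) (hκ : u + r + 1 ≤ κ * β) (hs1 : 1 ≤ s) (hsm : s ≤ m) (hl : 1 ≤ l)
    (hC : 1 ≤ C) (hr : 0 ≤ r) (hur : 1 ≤ u + r) :
    (2 : ℝ) ^ J * (2 * (A * ((m ^ κ : ℕ) : ℝ) ^ (-β))) ^ 2 ≤
      (C * (s ^ (1 - u - r) * l ^ (n * r))) ^ 2 / s := by
  have hm1 : (1 : ℝ) ≤ m := by exact_mod_cast hm
  have hm0 : (0 : ℝ) < m := by linarith
  have hs0 : 0 < s := by linarith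
  have h1 : ((m ^ κ : ℕ) : ℝ) ^ (-β) ≤ (m : ℝ) ^ (-(u + r + 1)) := by
    push_cast
    rw [← Real.rpow_natCast, ← Real.rpow_mul hm0.le]
    exact Real.rpow_le_rpow_of_exponent_le hm1 (by linarith)
  have h2 : (m : ℝ) ^ (-(u + r)) ≤ s ^ (-(u + r)) := by
    rw [Real.rpow_neg hm0.le, Real.rpow_neg hs0.le]
    exact inv_anti₀ (by positivity) (Real.rpow_le_rpow hs0.le hsm (by linarith))
  have h3 : (m : ℝ) ^ (-(u + r + 1)) = (m : ℝ) ^ (-(u + r)) * (m : ℝ)⁻¹ := by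
    rw [← Real.rpow_neg_one, ← Real.rpow_add hm0]; ring_nf
  have h4 : s ^ (1 - u - r) = s * s ^ (-(u + r)) := by
    rw [show 1 - u - r = 1 + -(u + r) by ring, Real.rpow_add hs0, Real.rpow_one]
  have h5 : s ^ (-(u + r)) ≤ C * (s ^ (-(u + r)) * l ^ (n * r)) := by
    have : 1 ≤ l ^ (n * r) := Real.one_le_rpow hl (by positivity)
    have h6 : 0 < s ^ (-(u + r)) := by positivity
    calc _ ≤ s ^ (-(u + r)) * l ^ (n * r) := le_mul_of_one_le_right h6.le this
      _ ≤ _ := le_mul_of_one_le_left (by positivity) hC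
  set Y := s ^ (-(u + r))
  have hY : 0 < Y := by positivity
  have h6 : A * ((m ^ κ : ℕ) : ℝ) ^ (-β) ≤ A * (Y * (m : ℝ)⁻¹) := by
    refine mul_le_mul_of_nonneg_left (h1.trans ?_) hA0
    rw [h3]
    exact mul_le_mul_of_nonneg_right h2 (by positivity)
  calc _ ≤ (2 * m) * (2 * (A * (Y * (m : ℝ)⁻¹))) ^ 2 := by gcongr
    _ = (8 * A ^ 2) * (m : ℝ)⁻¹ * Y ^ 2 := by field_simp; ring
    _ ≤ m * (m : ℝ)⁻¹ * Y ^ 2 := by gcongr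
    _ = Y ^ 2 := by rw [mul_inv_cancel₀ hm0.ne', one_mul]
    _ ≤ (C * (Y * l ^ (n * r))) ^ 2 := pow_le_pow_left₀ hY.le h5 2
    _ ≤ s * (C * (Y * l ^ (n * r))) ^ 2 := le_mul_of_one_le_left (sq_nonneg _) hs1
    _ = _ := by rw [h4]; field_simp

/-- upper bound for the non-linear sampling widths
`ρ_m(S^r_θ A)_{L_q}` (Theorem 6.1 of the paper). -/
theorem statement12 (d : ℕ) (hd : 1 ≤ d) (θ : ℝ≥0∞) (hθ : 0 < θ) (q : ℝ≥0∞)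
    (hq : 2 ≤ q) (r : ℝ) (hr : max (1 - 1/θ.toReal) 0 < r) :
    IsAsympLe (fun m => samplingWidth d m (wienerNorm d r θ) q)
      (fun m => (m : ℝ) ^ (-(r + 1/θ.toReal + 1/q.toReal - 1)) *
        logStar m ^ (((d : ℝ) - 1) * r + 3 * (r + 1/θ.toReal + 1/q.toReal - 1) + 1/2)) := by
  obtain ⟨n, rfl⟩ : ∃ n, d = n + 1 := ⟨d - 1, by omega⟩
  have hu0 : 0 ≤ 1 / θ.toReal := by positivity
  have hr0 : 0 < r := (le_max_right _ _).trans_lt hr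
  have hur : 1 - 1 / θ.toReal < r := (le_max_left _ _).trans_lt hr
  have hv : 0 ≤ 1 / q.toReal := by positivity
  obtain ⟨C, hC1, hsparse⟩ := exists_sparse_approx_logStar n hu0 hr0 hur
  obtain ⟨A, β, hA0, hβ, htail⟩ := exists_tail_le n hu0 hr
  set u := 1 / θ.toReal with hu
  set v := 1 / q.toReal
  obtain ⟨κ, hκ⟩ := exists_nat_ge ((u + r + 1) / β)
  rw [div_le_iff₀ hβ] at hκ
  set L : ℕ := (κ + 2) * (n + 1) + 3 with hL
  set K : ℝ := 2560000 * (L : ℝ) ^ 2 with hK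
  have hL1 : (1 : ℝ) ≤ L := by exact_mod_cast (by omega : 1 ≤ L)
  have hK1 : 2560000 ≤ K := le_mul_of_one_le_right (by norm_num) (one_le_pow₀ hL1)
  have hK0 : 0 < K := by linarith
  obtain ⟨m₁, hm₁⟩ := eventually_mul_logStar_pow_le (K * (2 ^ (n + 1) * 2 ^ n)) (n + 3)
  obtain ⟨m₂, hm₂⟩ := exists_nat_ge (8 * A ^ 2)
  refine ⟨5 * C * K ^ (r + u + v - 1), by positivity, max (max m₁ m₂) 2, fun m hm => ?_⟩
  have hm2 : 2 ≤ m := (le_max_right _ _).trans hm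
  have hmA : 8 * A ^ 2 ≤ m := hm₂.trans (by
    exact_mod_cast (le_max_right m₁ m₂).trans ((le_max_left _ _).trans hm))
  have hml := hm₁ m ((le_max_left m₁ m₂).trans ((le_max_left _ _).trans hm))
  have hm0 : (0 : ℝ) < m := by exact_mod_cast (by omega : 0 < m)
  set l := logStar m with hl
  have hl1 : 1 ≤ l := one_le_logStar m
  have hl0 : 0 < l := by linarith
  set J := Nat.log 2 m + 1 with hJ
  have hJl : (J : ℝ) ≤ 2 * l := natLog_add_one_le m (by omega)
  have hmJ : m ≤ 2 ^ J := (Nat.lt_pow_succ_log_self (by norm_num) m).le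
  have hJm : (2 : ℝ) ^ J ≤ 2 * m := by
    have := Nat.pow_log_le_self 2 (show m ≠ 0 by omega)
    rw [hJ, pow_succ, mul_comm]
    exact_mod_cast Nat.mul_le_mul_left 2 this
  set s := m / (K * l ^ 3) with hs
  have hKl : 1 ≤ K * l ^ 3 := one_le_mul_of_one_le_of_one_le (by linarith) (one_le_pow₀ hl1)
  have hsm : s ≤ m := div_le_self hm0.le hKl
  have hsZ : 2 ^ (n + 1) * (2 * l) ^ n ≤ s := by
    rw [hs, le_div_iff₀ (by linarith)]
    calc _ = K * (2 ^ (n + 1) * 2 ^ n) * l ^ (n + 3) := by ring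
      _ ≤ m := hml
  have hs1 : 1 ≤ s := (one_le_mul_of_one_le_of_one_le (one_le_pow₀ (by norm_num))
    (one_le_pow₀ (by linarith))).trans hsZ
  have hs0 : 0 < s := by linarith
  have hw := samplingWidth_le_of_params n m hθ hq (r := r) hr (M := m ^ κ) (J := J) (P := L * J)
    (s := s) (D := 1 / (16 * s)) (B := C * (s ^ (1 - u - r) * l ^ (n * r)))
    (η := A * ((m ^ κ : ℕ) : ℝ) ^ (-β)) (by omega) (Nat.le_mul_of_pos_left J (by omega))
    (five_mul_pow_le_exp hm2 hmJ) ?_ ?_ hs1 (mul_one_div_cancel (by positivity)).le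
    (fun b hb F => hsparse m s (by omega) hsm hsZ b hb F)
    (fun b hb F hF => htail b hb _ (by exact_mod_cast Nat.one_le_pow _ _ (by omega)) F hF)
    (tail_sq_le (by omega) hA0 hmA hJm hκ hs1 hsm hl1 hC1 hr0.le (by linarith))
  · refine hw.trans (ENNReal.ofReal_le_ofReal ?_)
    have he : 0 ≤ r + u + v - 1 := by linarith
    have h1 : s ^ (1 - u - r) * s ^ (-v) = K ^ (r + u + v - 1) *
        ((m : ℝ) ^ (-(r + u + v - 1)) * l ^ (3 * (r + u + v - 1))) := by
      rw [← Real.rpow_add hs0, show 1 - u - r + -v = -(r + u + v - 1) by ring, hs,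
        div_rpow hm0.le (by positivity), Real.rpow_neg (by positivity : 0 ≤ K * l ^ 3),
        div_inv_eq_mul, mul_rpow hK0.le (by positivity), ← Real.rpow_natCast l 3,
        ← Real.rpow_mul hl0.le]
      push_cast; ring
    calc 5 * (C * (s ^ (1 - u - r) * l ^ (n * r))) * s ^ (-v)
        = 5 * C * (s ^ (1 - u - r) * s ^ (-v)) * l ^ (n * r) := by ring
      _ = 5 * C * K ^ (r + u + v - 1) * ((m : ℝ) ^ (-(r + u + v - 1)) *
          l ^ (n * r + 3 * (r + u + v - 1))) := by
        rw [h1, Real.rpow_add hl0]; ring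
      _ ≤ _ := by
        refine mul_le_mul_of_nonneg_left (mul_le_mul_of_nonneg_left
          (Real.rpow_le_rpow_of_exponent_le hl1 ?_) (by positivity)) (by positivity)
        push_cast; linarith
  · have h1 : (m : ℝ) * (1 / (16 * s)) = K * l ^ 3 / 16 := by rw [hs]; field_simp
    rw [h1]
    push_cast
    calc 20000 * (J : ℝ) * (L * J) ^ 2 = 20000 * (L : ℝ) ^ 2 * (J : ℝ) ^ 3 := by ring
      _ ≤ 20000 * (L : ℝ) ^ 2 * (2 * l) ^ 3 := by gcongr
      _ = K * l ^ 3 / 16 := by rw [hK]; ring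
  · have h1 : 1 / (16 * s) / 8 = (K * l ^ 3 / 128) * (1 / m) := by rw [hs]; field_simp; norm_num
    rw [h1, one_div_pow]
    calc (1 : ℝ) / 2 ^ J ≤ 1 / m := one_div_le_one_div_of_le hm0 (by exact_mod_cast hmJ)
      _ ≤ _ := le_mul_of_one_le_left (by positivity) (by
        have := one_le_pow₀ (n := 3) hl1
        nlinarith)

end Paper
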